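/- arXiv:2212.09285 — 5 statements merged into one kernel-verified Lean document; each statement's English description precedes it below -/
import Mathlib

section
/- For every n, every circuit class 𝒞, every legitimate model ℳ of order n of 𝒞, and every Boolean function f ∈ ℱ_n, the distance satisfies ρ(f, ℳ) ≤ Size_𝒞(f). -/
open scoped Classical ENNReal

noncomputable section

/-- Boolean functions on `{0,1}^n`. -/
abbrev BF (n : ℕ) := (Fin n → Bool) → Bool

/-- A connective: an arity `m` together with a function `{0,1}^m → {0,1}`. -/
abbrev Conn := Σ m : ℕ, (Fin m → Bool) → Bool

/-- A connective is commutative if it is invariant under permutations of its inputs. -/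
def Conn.Comm (c : Conn) : Prop :=
  ∀ (π : Equiv.Perm (Fin c.1)) (v : Fin c.1 → Bool), c.2 (v ∘ π) = c.2 v

/-- A Boolean circuit (in straight-line / DAG form) with `n` inputs over the
set of connectives `S`.  Gate `i` may be wired to input variables, constants,
or earlier gates `j < i`; the size is the number of gates. -/
structure Circuit (n : ℕ) (S : Set Conn) where
  size : ℕ
  conn : Fin size → Conn
  conn_mem : ∀ i, conn i ∈ S
  wires : (i : Fin size) → Fin (conn i).1 → (Fin n ⊕ (Bool ⊕ Fin i.val))
  output : Fin n ⊕ (Bool ⊕ Fin size)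

namespace Circuit

variable {n : ℕ} {S : Set Conn}

/-- The value computed at gate `i` on input `x`. -/
def gateVal (C : Circuit n S) (x : Fin n → Bool) : ℕ → Bool
  | i =>
    if h : i < C.size then
      (C.conn ⟨i, h⟩).2 (fun k =>
        match C.wires ⟨i, h⟩ k with
        | Sum.inl v => x v
        | Sum.inr (Sum.inl b) => b
        | Sum.inr (Sum.inr j) => C.gateVal x j.val)
    else false
termination_by i => i
decreasing_by exact j.isLt

/-- Reading a port (input variable, constant, or gate). -/
def readPort (C : Circuit n S) (x : Fin n → Bool) : (Fin n ⊕ (Bool ⊕ Fin C.size)) → Bool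
  | Sum.inl v => x v
  | Sum.inr (Sum.inl b) => b
  | Sum.inr (Sum.inr g) => C.gateVal x g.val

/-- The function computed by the circuit. -/
def eval (C : Circuit n S) (x : Fin n → Bool) : Bool := C.readPort x C.output

def Computes (C : Circuit n S) (f : BF n) : Prop := ∀ x, C.eval x = f x

/-- The depth of gate `i` (number of edges on the longest path to an input or constant). -/
def gateDepth (C : Circuit n S) : ℕ → ℕ
  | i =>
    if h : i < C.size then
      1 + Finset.univ.sup (fun k =>
        match C.wires ⟨i, h⟩ k with
        | Sum.inl _ => 0
        | Sum.inr (Sum.inl _) => 0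
        | Sum.inr (Sum.inr j) => C.gateDepth j.val)
    else 0
termination_by i => i
decreasing_by exact j.isLt

/-- The depth of a circuit. -/
def depth (C : Circuit n S) : ℕ :=
  match C.output with
  | Sum.inl _ => 0
  | Sum.inr (Sum.inl _) => 0
  | Sum.inr (Sum.inr g) => C.gateDepth g.val

/-- The input variables of `C` are among `{x_j : j ∈ J}`. -/
def UsesVars (C : Circuit n S) (J : Set (Fin n)) : Prop :=
  (∀ (i : Fin C.size) (k : Fin (C.conn i).1) (v : Fin n), C.wires i k = Sum.inl v → v ∈ J) ∧
  (∀ v : Fin n, C.output = Sum.inl v → v ∈ J)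

end Circuit

/-- The size of the smallest circuit from the class `CC` computing `f`
(`⊤` if there is none). -/
def sizeIn {n : ℕ} {S : Set Conn} (CC : Set (Circuit n S)) (f : BF n) : ℕ∞ :=
  sInf {t : ℕ∞ | ∃ C ∈ CC, C.Computes f ∧ t = (C.size : ℕ∞)}

/-- Negation, binary conjunction and binary disjunction. -/
abbrev notConn : Conn := ⟨1, fun v => !(v 0)⟩
abbrev andConn : Conn := ⟨2, fun v => v 0 && v 1⟩
abbrev orConn : Conn := ⟨2, fun v => v 0 || v 1⟩

/-- The connectives `{¬, ∧₂, ∨₂}`. -/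
def S3 : Set Conn := {notConn, andConn, orConn}

/-- Unbounded fan-in conjunction and disjunction. -/
abbrev bigAnd (a : ℕ) : Conn := ⟨a, fun v => decide (∀ i, v i = true)⟩
abbrev bigOr (a : ℕ) : Conn := ⟨a, fun v => decide (∃ i, v i = true)⟩

/-- The connectives `∪_{a ≥ 2} {¬, ∧_a, ∨_a}`. -/
def Sunb : Set Conn := {c | c = notConn ∨ ∃ a : ℕ, 2 ≤ a ∧ (c = bigAnd a ∨ c = bigOr a)}

/-- The connectives `∪_{2 ≤ a ≤ t} {¬, ∧_a, ∨_a}`. -/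
def Sbdd (t : ℕ) : Set Conn :=
  {c | c = notConn ∨ ∃ a : ℕ, 2 ≤ a ∧ a ≤ t ∧ (c = bigAnd a ∨ c = bigOr a)}

/-- A legitimate model of order `n` of the circuit class with connectives `S`:
a set `M` of Boolean functions containing the constants and the variables,
together with a commutative approximating operation `∘̄ : M^m → M` for each
connective `∘ ∈ S` of arity `m`. -/
structure LegitModel (n : ℕ) (S : Set Conn) where
  M : Set (BF n)
  const_mem : ∀ b : Bool, (fun _ => b) ∈ M
  var_mem : ∀ i : Fin n, (fun x => x i) ∈ M
  approx : (c : Conn) → c ∈ S → ((Fin c.1 → M) → M)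
  approx_comm : ∀ (c : Conn) (hc : c ∈ S) (π : Equiv.Perm (Fin c.1)) (fs : Fin c.1 → M),
      approx c hc (fs ∘ π) = approx c hc fs

namespace LegitModel

variable {n : ℕ} {S : Set Conn}

/-- The error set `δ_∘(f_1,…,f_m) = ∘(f_1,…,f_m) ⊕ ∘̄(f_1,…,f_m)`. -/
def errSet (Mdl : LegitModel n S) (c : Conn) (hc : c ∈ S) (fs : Fin c.1 → Mdl.M) :
    Set (Fin n → Bool) :=
  {x | c.2 (fun k => (fs k).1 x) ≠ (Mdl.approx c hc fs).1 x}

/-- The collection `Δ` of all error sets of the model. -/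
def Delta (Mdl : LegitModel n S) : Set (Set (Fin n → Bool)) :=
  {δ | ∃ c : Conn, ∃ hc : c ∈ S, ∃ fs : Fin c.1 → Mdl.M, δ = Mdl.errSet c hc fs}

/-- `f ⊕ g` can be covered by `t` error sets, for some `g ∈ M`. -/
def CoversWith (Mdl : LegitModel n S) (f : BF n) (t : ℕ) : Prop :=
  ∃ g, g ∈ Mdl.M ∧ ∃ δs : Fin t → Set (Fin n → Bool),
    (∀ i, δs i ∈ Mdl.Delta) ∧ ∀ x, f x ≠ g x → ∃ i, x ∈ δs i

/-- The distance `ρ(f, M)`: the minimal number of error sets needed to cover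
`f ⊕ g` for some `g ∈ M` (`⊤` if impossible). -/
def rho (Mdl : LegitModel n S) (f : BF n) : ℕ∞ :=
  sInf {t : ℕ∞ | ∃ k : ℕ, t = (k : ℕ∞) ∧ Mdl.CoversWith f k}

/-- The approximating operation for negation is exact negation (`¬̄ := ¬`). -/
def NegExact (Mdl : LegitModel n S) : Prop :=
  ∀ (hc : notConn ∈ S) (fs : Fin 1 → Mdl.M),
    (Mdl.approx notConn hc fs).1 = fun x => !((fs 0).1 x)

end LegitModel

namespace Circuit

/-- The approximator of gate `i`, where the circuit inputs are substituted by
functions `σ` from the model. -/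
def gateApproxWith {n n' : ℕ} {S : Set Conn} (Mdl : LegitModel n S) (C : Circuit n' S)
    (σ : Fin n' → Mdl.M) : ℕ → Mdl.M
  | i =>
    if h : i < C.size then
      Mdl.approx (C.conn ⟨i, h⟩) (C.conn_mem ⟨i, h⟩) (fun k =>
        match C.wires ⟨i, h⟩ k with
        | Sum.inl v => σ v
        | Sum.inr (Sum.inl b) => ⟨fun _ => b, Mdl.const_mem b⟩
        | Sum.inr (Sum.inr j) => gateApproxWith Mdl C σ j.val)
    else ⟨fun _ => false, Mdl.const_mem false⟩
termination_by i => i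
decreasing_by exact j.isLt

/-- The function computed by the approximating circuit `C̄`, with circuit inputs
substituted by functions `σ` from the model. -/
def approxEvalWith {n n' : ℕ} {S : Set Conn} (Mdl : LegitModel n S) (C : Circuit n' S)
    (σ : Fin n' → Mdl.M) : Mdl.M :=
  match C.output with
  | Sum.inl v => σ v
  | Sum.inr (Sum.inl b) => ⟨fun _ => b, Mdl.const_mem b⟩
  | Sum.inr (Sum.inr g) => gateApproxWith Mdl C σ g.val

/-- The function computed by the approximating circuit `C̄` (inputs are the variables). -/
def approxEval {n : ℕ} {S : Set Conn} (Mdl : LegitModel n S) (C : Circuit n S) : Mdl.M :=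
  approxEvalWith Mdl C (fun i => ⟨fun x => x i, Mdl.var_mem i⟩)

end Circuit

namespace LegitModel

variable {n : ℕ} {S : Set Conn}

/-- Depth-`d` covering: as `CoversWith`, but the approximator `g` is the approximator of a
circuit of depth at most `d` and the input functions of the covering error sets are
approximators of circuits of depth at most `d - 1`. -/
def CoversWithD (Mdl : LegitModel n S) (f : BF n) (d t : ℕ) : Prop :=
  ∃ D : Circuit n S, D.depth ≤ d ∧
    ∃ δs : Fin t → Set (Fin n → Bool),
      (∀ i, ∃ c : Conn, ∃ hc : c ∈ S, ∃ fs : Fin c.1 → Mdl.M,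
        (∀ j, ∃ Cj : Circuit n S, Cj.depth ≤ d - 1 ∧ Circuit.approxEval Mdl Cj = fs j) ∧
        δs i = Mdl.errSet c hc fs) ∧
      ∀ x, f x ≠ (Circuit.approxEval Mdl D).1 x → ∃ i, x ∈ δs i

/-- The `d`-depth distance `ρ_d(f, M)`. -/
def rhoD (Mdl : LegitModel n S) (d : ℕ) (f : BF n) : ℕ∞ :=
  sInf {t : ℕ∞ | ∃ k : ℕ, t = (k : ℕ∞) ∧ Mdl.CoversWithD f d k}

/-- `0`-projectivity: the approximator of a circuit depends only on the variables
the circuit uses. -/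
def ZeroProjective (Mdl : LegitModel n S) : Prop :=
  ∀ (C : Circuit n S) (J : Set (Fin n)), C.UsesVars J →
    ∀ z y : Fin n → Bool, (∀ j ∈ J, z j = y j) →
      (Circuit.approxEval Mdl C).1 z = (Circuit.approxEval Mdl C).1 y

/-- Projectivity: the approximator of a circuit with inputs substituted by
`f_1, …, f_m ∈ M` depends only on the values `f_1(x), …, f_m(x)`. -/
def Projective (Mdl : LegitModel n S) : Prop :=
  ∀ (m : ℕ) (C : Circuit m S) (σ : Fin m → Mdl.M) (z y : Fin n → Bool),
    (∀ i, (σ i).1 z = (σ i).1 y) →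
      (Circuit.approxEvalWith Mdl C σ).1 z = (Circuit.approxEvalWith Mdl C σ).1 y

end LegitModel

/-- `Pr[𝐱 ∈ A]` for a distribution `p` on `{0,1}^n`. -/
def prOf {n : ℕ} (p : (Fin n → Bool) → ℝ) (A : Set (Fin n → Bool)) : ℝ :=
  ∑ x, A.indicator p x

/-- `p` is a (finitely supported) probability distribution on `{0,1}^n`. -/
def IsDistrib {n : ℕ} (p : (Fin n → Bool) → ℝ) : Prop :=
  (∀ x, 0 ≤ p x) ∧ (∑ x, p x) = 1

/-- The probabilistic distance `ρ(f, M, 𝐱) = min_{g ∈ M} Pr[f(𝐱) ≠ g(𝐱)] / d`. -/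
def LegitModel.rhoProb {n : ℕ} {S : Set Conn} (Mdl : LegitModel n S) (f : BF n)
    (p : (Fin n → Bool) → ℝ) (d : ℝ) : ℝ :=
  sInf {r : ℝ | ∃ g ∈ Mdl.M, r = prOf p {x | f x ≠ g x} / d}

/-- The variable `x_i` is essential for `f`. -/
def Essential {n : ℕ} (f : BF n) (i : Fin n) : Prop :=
  ∃ x, f (Function.update x i (!(x i))) ≠ f x

/-- The number `n₀` of essential variables of `f`. -/
def essCount {n : ℕ} (f : BF n) : ℕ := {i | Essential f i}.ncard

/-- An oracle circuit: a circuit over arbitrary (possibly noncommutative) connectives,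
together with a set of at most `k` designated oracle gates of arity `m`; all other
gates use connectives from `S`. -/
structure OracleCircuit (n : ℕ) (S : Set Conn) (k m : ℕ) where
  base : Circuit n Set.univ
  oracleGates : Finset (Fin base.size)
  card_le : oracleGates.card ≤ k
  arity_eq : ∀ i ∈ oracleGates, (base.conn i).1 = m
  conn_mem : ∀ i, i ∉ oracleGates → base.conn i ∈ S

/-- An oracle circuit whose `k` oracle gates of arity `m` are at the bottom, with
inputs among the literals `x_1, ¬x_1, …, x_n, ¬x_n`: each oracle `i` reads the
literals described by `lits i`, and the top circuit over `S` has the `n` variables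
and the `k` oracle outputs as inputs.  Its size is `top.size + k`. -/
structure BottomOracleCircuit (n k m : ℕ) (S : Set Conn) where
  oracles : Fin k → (Fin m → Bool) → Bool
  lits : Fin k → Fin m → Fin n × Bool
  top : Circuit (n + k) S

/-- Evaluation of a bottom-oracle circuit. -/
def BottomOracleCircuit.eval {n k m : ℕ} {S : Set Conn} (C : BottomOracleCircuit n k m S)
    (x : Fin n → Bool) : Bool :=
  C.top.eval (Fin.append x (fun i => C.oracles i (fun j => x (C.lits i j).1 == (C.lits i j).2)))

/-- Ceiling division `⌈a / b⌉` on natural numbers. -/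
def natCeilDiv (a b : ℕ) : ℕ := (a + b - 1) / b

end

noncomputable section

def gateArgs {n : ℕ} {S : Set Conn} (C : Circuit n S) (Mdl : LegitModel n S)
    (σ : Fin n → Mdl.M) (i : ℕ) (h : i < C.size) : Fin (C.conn ⟨i, h⟩).1 → Mdl.M := fun k =>
  match C.wires ⟨i, h⟩ k with
  | Sum.inl v => σ v
  | Sum.inr (Sum.inl b) => ⟨fun _ => b, Mdl.const_mem b⟩
  | Sum.inr (Sum.inr j) => Circuit.gateApproxWith Mdl C σ j.val

theorem gate_ok {n : ℕ} {S : Set Conn} (C : Circuit n S) (Mdl : LegitModel n S)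
    (σ : Fin n → Mdl.M) (hσ : ∀ i x, (σ i).1 x = x i) (x : Fin n → Bool)
    (H : ∀ (i : ℕ) (h : i < C.size), x ∉ Mdl.errSet (C.conn ⟨i, h⟩) (C.conn_mem ⟨i, h⟩)
      (gateArgs C Mdl σ i h)) (i : ℕ) :
    C.gateVal x i = (Circuit.gateApproxWith Mdl C σ i).1 x := by
  induction i using Nat.strong_induction_on with
  | _ i ih =>
    rw [Circuit.gateVal, Circuit.gateApproxWith]
    split_ifs with h
    · have h1 : (C.conn ⟨i, h⟩).2 (fun k => (gateArgs C Mdl σ i h k).1 x) =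
          (Mdl.approx _ (C.conn_mem ⟨i, h⟩) (gateArgs C Mdl σ i h)).1 x := not_not.1 (H i h)
      refine Eq.trans (congrArg (C.conn ⟨i, h⟩).2 ?_) h1
      funext k
      unfold gateArgs
      rcases C.wires ⟨i, h⟩ k with v | b | j
      · exact (hσ v x).symm
      · rfl
      · exact ih j.val j.isLt
    · rfl

theorem stmt0 {n : ℕ} {S : Set Conn} (hS : ∀ c ∈ S, Conn.Comm c)
    (CC : Set (Circuit n S)) (Mdl : LegitModel n S) (f : BF n) :
    Mdl.rho f ≤ sizeIn CC f := by
  refine le_sInf ?_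
  rintro t ⟨C, -, hC, rfl⟩
  refine sInf_le ⟨C.size, rfl, (Circuit.approxEval Mdl C).1, (Circuit.approxEval Mdl C).2,
    fun i => Mdl.errSet (C.conn i) (C.conn_mem i) 
      (gateArgs C Mdl (fun i => ⟨fun x => x i, Mdl.var_mem i⟩) i.1 i.2), fun i => ⟨_, _, _, rfl⟩, ?_⟩
  intro x hx
  by_contra hne
  apply hx
  have key := gate_ok C Mdl (fun i => ⟨fun x => x i, Mdl.var_mem i⟩) (fun _ _ => rfl) x
    (fun i h hm => hne ⟨⟨i, h⟩, hm⟩)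
  rw [← hC x, Circuit.eval, Circuit.approxEval, Circuit.approxEvalWith]
  rcases C.output with v | b | g
  · rfl
  · rfl
  · exact key g.val

end
end

section
/- There is an absolute constant K such that for every n, every legitimate model ℳ of order n of the class of Boolean circuits over {¬, ∧₂, ∨₂} with ¬̄ := ¬, and every f ∈ ℱ_n with n₀ essential variables, ρ(f, ℳ) ≤ K · n₀ · n. -/
open scoped Classical ENNReal

noncomputable section

namespace Stmt2Aux

/-- decision trees of depth `k` -/
def T : ℕ → Type
  | 0 => Bool
  | k + 1 => T k × T k

instance instFT : (k : ℕ) → Fintype (T k)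
  | 0 => inferInstanceAs (Fintype Bool)
  | k + 1 => @instFintypeProd (T k) (T k) (instFT k) (instFT k)

instance instNE : (k : ℕ) → Nonempty (T k)
  | 0 => inferInstanceAs (Nonempty Bool)
  | k + 1 => @instNonemptyProd (T k) (T k) (instNE k) (instNE k)

def xorT : (k : ℕ) → T k → T k → T k
  | 0 => fun a b => Bool.xor a b
  | k + 1 => fun a b => (xorT k a.1 b.1, xorT k a.2 b.2)

lemma xorT_invol : ∀ (k : ℕ) (a b : T k), xorT k a (xorT k a b) = b
  | 0, a, b => by
      have h : ∀ a b : Bool, Bool.xor a (Bool.xor a b) = b := by decide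
      exact h a b
  | k + 1, a, b => by
      change ((xorT k a.1 (xorT k a.1 b.1), xorT k a.2 (xorT k a.2 b.2)) : T k × T k) = b
      rw [xorT_invol k, xorT_invol k]
      rfl

variable {n : ℕ}

def ev (σ : ℕ → Fin n) : (k : ℕ) → T k → BF n
  | 0 => fun t _ => t
  | k + 1 => fun t x => if x (σ k) = true then ev σ k t.2 x else ev σ k t.1 x

lemma ev_xor (σ : ℕ → Fin n) (x : Fin n → Bool) : ∀ (k : ℕ) (a b : T k),
    ev σ k (xorT k a b) x = Bool.xor (ev σ k a x) (ev σ k b x)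
  | 0, a, b => rfl
  | k + 1, a, b => by
      simp only [ev, xorT]
      split <;> rw [ev_xor σ x k]

lemma exists_ev (σ : ℕ → Fin n) : ∀ (k : ℕ) (f : BF n),
    (∀ x y : Fin n → Bool, (∀ i < k, x (σ i) = y (σ i)) → f x = f y) → ∃ t, ev σ k t = f
  | 0, f, h => ⟨f (fun _ => false), by
      funext x
      exact h _ _ (by simp)⟩
  | k + 1, f, h => by
      have key : ∀ b : Bool, ∃ t, ev σ k t = fun x => f (Function.update x (σ k) b) := by
        intro b
        apply exists_ev σ k
        intro x y hxy
        apply h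
        intro i hi
        by_cases e : σ i = σ k
        · rw [e]; simp
        · rw [Function.update_of_ne e, Function.update_of_ne e]
          apply hxy
          have : i ≠ k := by rintro rfl; exact e rfl
          omega
      obtain ⟨t1, h1⟩ := key true
      obtain ⟨t0, h0⟩ := key false
      refine ⟨((t0, t1) : T k × T k), ?_⟩
      funext x
      simp only [ev]
      split
      · rename_i hx
        rw [h1]
        simp only
        rw [← hx, Function.update_eq_self]
      · rename_i hx
        rw [h0]
        simp only
        have hx : x (σ k) = false := by simpa using hx
        rw [← hx, Function.update_eq_self]

lemma dep_ess (f : BF n) : ∀ (D : Finset (Fin n)), (∀ i ∈ D, ¬ Essential f i) →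
    ∀ x y : Fin n → Bool, (∀ i, i ∉ D → x i = y i) → f x = f y := by
  intro D
  induction D using Finset.induction_on with
  | empty =>
    intro _ x y h
    congr 1
    funext i
    exact h i (by simp)
  | insert a s ha ih =>
    intro hD x y h
    have hne : ¬ Essential f a := hD a (by simp)
    have h1 : f x = f (Function.update x a (y a)) := by
      by_cases e : y a = x a
      · rw [e, Function.update_eq_self]
      · have e2 : y a = !(x a) := by
          revert e; cases y a <;> cases x a <;> simp
        rw [e2]
        by_contra hc
        exact hne ⟨x, fun h => hc h.symm⟩
    rw [h1]
    apply ih (fun i hi => hD i (by simp [hi]))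
    intro i hi
    by_cases e : i = a
    · subst e; simp
    · rw [Function.update_of_ne e]
      exact h i (by simp [e, hi])

lemma greedy {Ω Y : Type*} [Fintype Ω] (s : Finset Y) (w : Ω → ℝ) (hw : ∀ o, 0 < w o)
    (hs : ∑ o, w o = 1) (W : Ω → Y → ℝ) (hW : ∀ o y, 0 ≤ W o y) (r : ℝ) (hr : 0 ≤ r)
    (h : ∀ y ∈ s, ∑ o, w o * W o y ≤ r) (m : ℕ) :
    ∃ L : List Ω, L.length = m ∧
      ∑ y ∈ s, (L.map (fun o => W o y)).prod ≤ r ^ m * s.card := by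
  induction m with
  | zero => exact ⟨[], rfl, by simp⟩
  | succ m ih =>
    obtain ⟨L, hL, hS⟩ := ih
    have hP : ∀ y, 0 ≤ (L.map (fun o => W o y)).prod := by
      intro y
      apply List.prod_nonneg
      simp only [List.mem_map]
      rintro _ ⟨o, _, rfl⟩
      exact hW o y
    set P : Y → ℝ := fun y => (L.map (fun o => W o y)).prod with hPdef
    have hne : (Finset.univ : Finset Ω).Nonempty := by
      by_contra hc
      rw [Finset.not_nonempty_iff_eq_empty] at hc
      rw [hc] at hs
      simp at hs
    have hsum : ∑ o, w o * ∑ y ∈ s, W o y * P y ≤ ∑ o, w o * (r * ∑ y ∈ s, P y) := by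
      rw [← Finset.sum_mul, hs, one_mul]
      simp_rw [Finset.mul_sum]
      rw [Finset.sum_comm]
      apply Finset.sum_le_sum
      intro y hy
      calc ∑ o, w o * (W o y * P y) = (∑ o, w o * W o y) * P y := by
            rw [Finset.sum_mul]
            exact Finset.sum_congr rfl (fun o _ => by ring)
        _ ≤ r * P y := mul_le_mul_of_nonneg_right (h y hy) (hP y)
    obtain ⟨o, _, ho⟩ := Finset.exists_le_of_sum_le hne hsum
    have ho' := le_of_mul_le_mul_left ho (hw o)
    refine ⟨o :: L, by simp [hL], ?_⟩
    simp only [List.map_cons, List.prod_cons]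
    calc _ ≤ r * ∑ y ∈ s, P y := ho'
      _ ≤ r * (r ^ m * s.card) := mul_le_mul_of_nonneg_left hS hr
      _ = _ := by ring

variable (Mdl : LegitModel n S3)

lemma hAnd : andConn ∈ S3 := by simp [S3]
lemma hOr : orConn ∈ S3 := by simp [S3]
lemma hNot : notConn ∈ S3 := by simp [S3]

def IsU (k : ℕ) (U : Set (Fin n → Bool)) : Prop :=
  ∃ L : List (Set (Fin n → Bool)), L.length ≤ k ∧ (∀ δ ∈ L, δ ∈ Mdl.Delta) ∧
    ∀ x ∈ U, ∃ δ ∈ L, x ∈ δ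

lemma IsU.empty : IsU Mdl 0 ∅ := ⟨[], by simp, by simp, by simp⟩

variable {Mdl}

lemma IsU.mono {k l : ℕ} {U : Set (Fin n → Bool)} (h : IsU Mdl k U) (hkl : k ≤ l) :
    IsU Mdl l U := by
  obtain ⟨L, h1, h2⟩ := h
  exact ⟨L, h1.trans hkl, h2⟩

lemma IsU.union {k l : ℕ} {U V : Set (Fin n → Bool)} (h : IsU Mdl k U) (h' : IsU Mdl l V) :
    IsU Mdl (k + l) (U ∪ V) := by
  obtain ⟨L, h1, h2, h3⟩ := h
  obtain ⟨L', h1', h2', h3'⟩ := h'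
  refine ⟨L ++ L', by simp; omega, ?_, ?_⟩
  · intro δ hδ
    rcases List.mem_append.1 hδ with h | h
    · exact h2 δ h
    · exact h2' δ h
  · rintro x (hx | hx)
    · obtain ⟨δ, a, b⟩ := h3 x hx
      exact ⟨δ, by simp [a], b⟩
    · obtain ⟨δ, a, b⟩ := h3' x hx
      exact ⟨δ, by simp [a], b⟩

lemma IsU.single {δ : Set (Fin n → Bool)} (h : δ ∈ Mdl.Delta) : IsU Mdl 1 δ :=
  ⟨[δ], by simp, by simpa using h, fun x hx => ⟨δ, by simp, hx⟩⟩

variable (Mdl)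

def andM (a b : Mdl.M) : Mdl.M := Mdl.approx andConn hAnd ![a, b]
def orM (a b : Mdl.M) : Mdl.M := Mdl.approx orConn hOr ![a, b]
def notM (a : Mdl.M) : Mdl.M := Mdl.approx notConn hNot ![a]
def eAnd (a b : Mdl.M) : Set (Fin n → Bool) := Mdl.errSet andConn hAnd ![a, b]
def eOr (a b : Mdl.M) : Set (Fin n → Bool) := Mdl.errSet orConn hOr ![a, b]

lemma eAnd_mem (a b : Mdl.M) : eAnd Mdl a b ∈ Mdl.Delta := ⟨_, hAnd, _, rfl⟩
lemma eOr_mem (a b : Mdl.M) : eOr Mdl a b ∈ Mdl.Delta := ⟨_, hOr, _, rfl⟩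

lemma andM_eq {a b : Mdl.M} {x : Fin n → Bool} (h : x ∉ eAnd Mdl a b) :
    (andM Mdl a b).1 x = (a.1 x && b.1 x) := by
  simp only [eAnd, LegitModel.errSet, Set.mem_ofPred_eq, not_not] at h
  exact h.symm

lemma orM_eq {a b : Mdl.M} {x : Fin n → Bool} (h : x ∉ eOr Mdl a b) :
    (orM Mdl a b).1 x = (a.1 x || b.1 x) := by
  simp only [eOr, LegitModel.errSet, Set.mem_ofPred_eq, not_not] at h
  exact h.symm

lemma notM_eq (hN : Mdl.NegExact) (a : Mdl.M) (x : Fin n → Bool) :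
    (notM Mdl a).1 x = !(a.1 x) := by
  have := hN hNot ![a]
  exact congrFun this x

/-- `φ` is represented exactly outside `U` -/
def Rep (U : Set (Fin n → Bool)) (φ : BF n) : Prop :=
  ∃ g : Mdl.M, ∀ x, x ∉ U → g.1 x = φ x

variable {Mdl}

lemma Rep.mono {U V : Set (Fin n → Bool)} {φ : BF n} (h : Rep Mdl U φ) (hUV : U ⊆ V) :
    Rep Mdl V φ := by
  obtain ⟨g, hg⟩ := h
  exact ⟨g, fun x hx => hg x (fun h => hx (hUV h))⟩

lemma Rep.not (hN : Mdl.NegExact) {U : Set (Fin n → Bool)} {φ : BF n} (h : Rep Mdl U φ) :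
    Rep Mdl U (fun x => !(φ x)) := by
  obtain ⟨g, hg⟩ := h
  exact ⟨notM Mdl g, fun x hx => by rw [notM_eq Mdl hN, hg x hx]⟩

lemma Rep.and {U : Set (Fin n → Bool)} {φ ψ : BF n} (h : Rep Mdl U φ) (h' : Rep Mdl U ψ) :
    ∃ V, IsU Mdl 1 V ∧ Rep Mdl (U ∪ V) (fun x => φ x && ψ x) := by
  obtain ⟨a, ha⟩ := h
  obtain ⟨b, hb⟩ := h'
  refine ⟨_, IsU.single (eAnd_mem Mdl a b), andM Mdl a b, fun x hx => ?_⟩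
  simp only [Set.mem_union, not_or] at hx
  rw [andM_eq Mdl hx.2, ha x hx.1, hb x hx.1]

lemma Rep.or {U : Set (Fin n → Bool)} {φ ψ : BF n} (h : Rep Mdl U φ) (h' : Rep Mdl U ψ) :
    ∃ V, IsU Mdl 1 V ∧ Rep Mdl (U ∪ V) (fun x => φ x || ψ x) := by
  obtain ⟨a, ha⟩ := h
  obtain ⟨b, hb⟩ := h'
  refine ⟨_, IsU.single (eOr_mem Mdl a b), orM Mdl a b, fun x hx => ?_⟩
  simp only [Set.mem_union, not_or] at hx
  rw [orM_eq Mdl hx.2, ha x hx.1, hb x hx.1]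

lemma Rep.xor (hN : Mdl.NegExact) {U : Set (Fin n → Bool)} {φ ψ : BF n}
    (h : Rep Mdl U φ) (h' : Rep Mdl U ψ) :
    ∃ V, IsU Mdl 3 V ∧ Rep Mdl (U ∪ V) (fun x => Bool.xor (φ x) (ψ x)) := by
  obtain ⟨V1, u1, r1⟩ := h.and (h'.not hN)
  obtain ⟨V2, u2, r2⟩ := (h.not hN).and h'
  obtain ⟨V3, u3, r3⟩ := (r1.mono (V := U ∪ (V1 ∪ V2)) (by intro x; simp; tauto)).or
    (r2.mono (V := U ∪ (V1 ∪ V2)) (by intro x; simp; tauto))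
  refine ⟨V1 ∪ V2 ∪ V3, (u1.union u2).union u3, ?_⟩
  rw [← Set.union_assoc]
  obtain ⟨g, hg⟩ := r3
  refine ⟨g, fun x hx => ?_⟩
  rw [hg x hx]
  change (φ x && !ψ x || !φ x && ψ x) = Bool.xor (φ x) (ψ x)
  cases φ x <;> cases ψ x <;> rfl

/-- one increment of a counter -/
lemma incr_aux (hN : Mdl.NegExact) {U : Set (Fin n → Bool)} (c : (Fin n → Bool) → ℕ) (v : BF n)
    (K : ℕ) (hc : ∀ i < K, Rep Mdl U (fun x => decide (c x / 2 ^ i % 2 = 1)))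
    (hv : Rep Mdl U v) : ∀ k ≤ K, ∃ V, IsU Mdl (4 * k) V ∧
      (∀ i < k, Rep Mdl (U ∪ V) (fun x => decide ((c x + (v x).toNat) / 2 ^ i % 2 = 1))) ∧
      ∃ r : BF n, Rep Mdl (U ∪ V) r ∧
        ∀ x, (c x + (v x).toNat) / 2 ^ k = c x / 2 ^ k + (r x).toNat := by
  intro k
  induction k with
  | zero =>
    intro _
    exact ⟨∅, IsU.empty Mdl, by simp, v, by simpa using hv, by simp⟩
  | succ k ih =>
    intro hk
    obtain ⟨V, hV, hb, r, hr, hrx⟩ := ih (by omega)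
    have hck := (hc k (by omega)).mono (Set.subset_union_left (t := V))
    obtain ⟨V1, u1, r1⟩ := hck.xor hN hr
    obtain ⟨V2, u2, r2⟩ := hck.and hr
    refine ⟨V ∪ (V1 ∪ V2), (hV.union (u1.union u2)).mono (by omega), ?_, _,
      r2.mono (by intro x; simp; tauto), ?_⟩
    · intro i hi
      rcases Nat.lt_succ_iff_lt_or_eq.1 hi with hi | rfl
      · exact (hb i hi).mono (by intro x; simp; tauto)
      · have := r1.mono (V := U ∪ (V ∪ (V1 ∪ V2))) (by intro x; simp; tauto)
        convert this using 2 with x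
        rw [hrx x]
        cases r x
        · simp
        · simp only [Bool.toNat_true, Bool.xor_true]
          rw [← decide_not, decide_eq_decide]
          omega
    · intro x
      rw [pow_succ, ← Nat.div_div_eq_div_mul, ← Nat.div_div_eq_div_mul, hrx x]
      cases r x
      · simp
      · by_cases h : c x / 2 ^ k % 2 = 1
        · simp [h]; omega
        · simp [h]; omega

lemma counter (hN : Mdl.NegExact) (K : ℕ) (vs : List (BF n)) :
    ∀ {U : Set (Fin n → Bool)} (c : (Fin n → Bool) → ℕ)
    (_ : ∀ i < K, Rep Mdl U (fun x => decide (c x / 2 ^ i % 2 = 1)))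
    (_ : ∀ v ∈ vs, Rep Mdl U v), ∃ V, IsU Mdl (4 * K * vs.length) V ∧
      ∀ i < K, Rep Mdl (U ∪ V)
        (fun x => decide ((c x + (vs.map (fun v => (v x).toNat)).sum) / 2 ^ i % 2 = 1)) := by
  induction vs with
  | nil =>
    intro U c hc _
    exact ⟨∅, IsU.empty Mdl, by simpa using hc⟩
  | cons v vs ih =>
    intro U c hc hv
    obtain ⟨V, hV, hb, -⟩ := incr_aux hN c v K hc (hv v (by simp)) K le_rfl
    obtain ⟨V', hV', hb'⟩ := ih (U := U ∪ V) (fun x => c x + (v x).toNat) hb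
      (fun w hw => (hv w (by simp [hw])).mono Set.subset_union_left)
    refine ⟨V ∪ V', (hV.union hV').mono (by simp; ring_nf; omega), ?_⟩
    intro i hi
    rw [← Set.union_assoc]
    simpa [add_assoc] using hb' i hi

lemma xorList (hN : Mdl.NegExact) (ps : List (BF n × BF n)) : ∀ {U : Set (Fin n → Bool)}
    (_ : ∀ p ∈ ps, Rep Mdl U p.1 ∧ Rep Mdl U p.2), ∃ V, IsU Mdl (3 * ps.length) V ∧
      ∀ p ∈ ps, Rep Mdl (U ∪ V) (fun x => Bool.xor (p.1 x) (p.2 x)) := by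
  induction ps with
  | nil => intro U _; exact ⟨∅, IsU.empty Mdl, by simp⟩
  | cons p ps ih =>
    intro U h
    obtain ⟨V, hV, hb⟩ := ih (U := U) (fun p hp => h p (by simp [hp]))
    obtain ⟨V', hV', hb'⟩ := (h p (by simp)).1.xor hN (h p (by simp)).2
    refine ⟨V ∪ V', (hV.union hV').mono (by simp; omega), ?_⟩
    intro q hq
    rcases List.mem_cons.1 hq with rfl | hq
    · exact hb'.mono (by intro x; simp; tauto)
    · exact (hb q hq).mono (by intro x; simp; tauto)

variable (Mdl)

def varM (i : Fin n) : Mdl.M := ⟨fun x => x i, Mdl.var_mem i⟩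
def constM (b : Bool) : Mdl.M := ⟨fun _ => b, Mdl.const_mem b⟩

def A (σ : ℕ → Fin n) : (k : ℕ) → T k → Mdl.M
  | 0 => fun t => constM Mdl t
  | k + 1 => fun t => orM Mdl (andM Mdl (varM Mdl (σ k)) (A σ k t.2))
      (andM Mdl (notM Mdl (varM Mdl (σ k))) (A σ k t.1))

def Er (σ : ℕ → Fin n) (k : ℕ) (t : T (k + 1)) : Set (Fin n → Bool) :=
  eAnd Mdl (varM Mdl (σ k)) (A Mdl σ k t.2) ∪
  eAnd Mdl (notM Mdl (varM Mdl (σ k))) (A Mdl σ k t.1) ∪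
  eOr Mdl (andM Mdl (varM Mdl (σ k)) (A Mdl σ k t.2))
      (andM Mdl (notM Mdl (varM Mdl (σ k))) (A Mdl σ k t.1))

lemma Er_isU (σ : ℕ → Fin n) (k : ℕ) (t : T (k + 1)) : IsU Mdl 3 (Er Mdl σ k t) :=
  ((IsU.single (eAnd_mem Mdl _ _)).union (IsU.single (eAnd_mem Mdl _ _))).union
    (IsU.single (eOr_mem Mdl _ _))

lemma A_step (hN : Mdl.NegExact) (σ : ℕ → Fin n) (k : ℕ) (t : T (k + 1)) (x : Fin n → Bool)
    (hx : x ∉ Er Mdl σ k t) :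
    (A Mdl σ (k + 1) t).1 x =
      if x (σ k) = true then (A Mdl σ k t.2).1 x else (A Mdl σ k t.1).1 x := by
  simp only [Er, Set.mem_union, not_or] at hx
  simp only [A]
  rw [orM_eq Mdl hx.2, andM_eq Mdl hx.1.1, andM_eq Mdl hx.1.2, notM_eq Mdl hN]
  simp only [varM]
  cases x (σ k) <;> simp

lemma tree_rep (hN : Mdl.NegExact) (σ : ℕ → Fin n) : ∀ (k : ℕ) (t : T k),
    ∃ U, IsU Mdl (3 * (2 ^ k - 1)) U ∧ ∀ x, x ∉ U → (A Mdl σ k t).1 x = ev σ k t x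
  | 0, t => ⟨∅, IsU.empty Mdl, fun x _ => rfl⟩
  | k + 1, t => by
      obtain ⟨U1, h1, e1⟩ := tree_rep hN σ k t.1
      obtain ⟨U2, h2, e2⟩ := tree_rep hN σ k t.2
      refine ⟨U1 ∪ U2 ∪ Er Mdl σ k t, ((h1.union h2).union (Er_isU Mdl σ k t)).mono ?_, ?_⟩
      · have := Nat.one_le_two_pow (n := k)
        rw [pow_succ]
        omega
      · intro x hx
        simp only [Set.mem_union, not_or] at hx
        rw [A_step Mdl hN σ k t x hx.2, e1 x hx.1.1, e2 x hx.1.2]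
        rfl

/-- fraction of trees with an error at the root -/
def q (σ : ℕ → Fin n) (k : ℕ) (x : Fin n → Bool) : ℝ :=
  (∑ t : T (k + 1), if x ∈ Er Mdl σ k t then (1 : ℝ) else 0) / Fintype.card (T (k + 1))

/-- fraction of trees evaluated wrongly -/
def bad (σ : ℕ → Fin n) (k : ℕ) (x : Fin n → Bool) : ℝ :=
  (∑ t : T k, if (A Mdl σ k t).1 x ≠ ev σ k t x then (1 : ℝ) else 0) / Fintype.card (T k)

lemma card_succ (k : ℕ) : Fintype.card (T (k + 1)) = Fintype.card (T k) * Fintype.card (T k) :=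
  Fintype.card_prod (T k) (T k)

lemma sum_succ (k : ℕ) (F : T (k + 1) → ℝ) :
    ∑ t : T (k + 1), F t = ∑ a : T k, ∑ b : T k, F ((a, b) : T k × T k) :=
  Fintype.sum_prod_type (f := (F : T k × T k → ℝ))

lemma bad_step (hN : Mdl.NegExact) (σ : ℕ → Fin n) (k : ℕ) (x : Fin n → Bool) :
    bad Mdl σ (k + 1) x ≤ q Mdl σ k x + bad Mdl σ k x := by
  have hc : (0 : ℝ) < Fintype.card (T k) := by exact_mod_cast Fintype.card_pos
  let B : T k → ℝ := fun t => if (A Mdl σ k t).1 x ≠ ev σ k t x then (1 : ℝ) else 0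
  have hB : bad Mdl σ k x = (∑ t : T (k + 1),
      if x (σ k) = true then B t.2 else B t.1) / Fintype.card (T (k + 1)) := by
    have e : bad Mdl σ k x = (∑ t, B t) / Fintype.card (T k) := rfl
    rw [sum_succ, card_succ, e]
    push_cast
    by_cases h : x (σ k) = true
    · simp only [h, if_true]
      change _ = (∑ _a : T k, ∑ b : T k, B b) / _
      rw [Finset.sum_const, Finset.card_univ, nsmul_eq_mul]
      field_simp
    · simp only [h]
      change _ = (∑ a : T k, ∑ _b : T k, B a) / _
      simp only [Finset.sum_const, Finset.card_univ, nsmul_eq_mul]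
      rw [← Finset.mul_sum]
      field_simp
  rw [hB, bad, q, ← add_div, ← Finset.sum_add_distrib]
  apply div_le_div_of_nonneg_right _ (by positivity)
  apply Finset.sum_le_sum
  intro t _
  by_cases hE : x ∈ Er Mdl σ k t
  · rw [if_pos hE]
    simp only [B]
    split_ifs <;> norm_num
  · rw [if_neg hE, A_step Mdl hN σ k t x hE, zero_add]
    simp only [ev, B]
    by_cases h : x (σ k) = true
    · simp only [h, if_true]; exact le_rfl
    · simp only [h]; exact le_rfl

lemma bad_le (hN : Mdl.NegExact) (σ : ℕ → Fin n) (x : Fin n → Bool) (k : ℕ) :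
    bad Mdl σ k x ≤ ∑ i ∈ Finset.range k, q Mdl σ i x := by
  induction k with
  | zero =>
    have e : ∀ t : T 0, (A Mdl σ 0 t).1 x = ev σ 0 t x := fun _ => rfl
    simp [bad, e]
  | succ k ih =>
    rw [Finset.sum_range_succ]
    have := bad_step Mdl hN σ k x
    linarith

lemma isU_list {Ω : Type*} (c : ℕ) (E : Ω → Set (Fin n → Bool)) (hE : ∀ o, IsU Mdl c (E o))
    (L : List Ω) : IsU Mdl (c * L.length) {x | ∃ o ∈ L, x ∈ E o} := by
  induction L with
  | nil => exact (IsU.empty Mdl).mono (by simp) |> fun h => by simpa using h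
  | cons o L ih =>
    have := (ih.union (hE o)).mono (l := c * (o :: L).length) (by simp; ring_nf; omega)
    convert this using 1
    ext x
    simp [or_comm]

/-- Stage 1. -/
lemma stage1 (σ : ℕ → Fin n) (N : ℕ) (hNpos : 0 < N) (hn : 0 < n) :
    ∃ U, IsU Mdl (90 * N * n) U ∧
      ∀ x, x ∉ U → ∑ i ∈ Finset.range N, q Mdl σ i x < 1 / 30 := by
  have hNR : (0 : ℝ) < N := by exact_mod_cast hNpos
  have hcard : ∀ k, (0 : ℝ) < Fintype.card (T k) := fun k => by
    exact_mod_cast Fintype.card_pos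
  let Ω := Σ i : Fin N, T (i.1 + 1)
  let E : Ω → Set (Fin n → Bool) := fun o => Er Mdl σ o.1.1 o.2
  let s : Finset (Fin n → Bool) :=
    Finset.univ.filter (fun x => 1 / 30 ≤ ∑ i ∈ Finset.range N, q Mdl σ i x)
  let w : Ω → ℝ := fun o => 1 / (N * Fintype.card (T (o.1.1 + 1)))
  have hwsum : ∑ o, w o = 1 := by
    rw [Fintype.sum_sigma]
    change ∑ i : Fin N, ∑ _t : T (i.1 + 1), (1 : ℝ) / (N * Fintype.card (T (i.1 + 1))) = 1
    simp only [Finset.sum_const, Finset.card_univ, nsmul_eq_mul]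
    have : ∀ i : Fin N, (Fintype.card (T (i.1 + 1)) : ℝ) *
        (1 / (N * Fintype.card (T (i.1 + 1)))) = 1 / N := by
      intro i
      have := hcard (i.1 + 1)
      field_simp
    simp only [this, Finset.sum_const, Finset.card_univ, nsmul_eq_mul, Fintype.card_fin]
    field_simp
  have hcov : ∀ x, ∑ o, w o * (if x ∈ E o then (1 : ℝ) else 0) =
      (∑ i ∈ Finset.range N, q Mdl σ i x) / N := by
    intro x
    rw [Fintype.sum_sigma, Finset.sum_range, Finset.sum_div]
    apply Finset.sum_congr rfl
    intro i _
    change ∑ t : T (i.1 + 1), (1 : ℝ) / (N * Fintype.card (T (i.1 + 1))) *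
      (if x ∈ Er Mdl σ i.1 t then (1 : ℝ) else 0) = q Mdl σ i.1 x / N
    rw [← Finset.mul_sum, q]
    have := hcard (i.1 + 1)
    field_simp
  obtain ⟨L, hL, hS⟩ := greedy s w (fun o => by have := hcard (o.1.1 + 1); positivity) hwsum
    (fun o x => if x ∈ E o then (0 : ℝ) else 1) (by intro o y; split_ifs <;> norm_num)
    (1 - 1 / (30 * N)) (by
      have : (1 : ℝ) ≤ N := by exact_mod_cast hNpos
      rw [sub_nonneg, div_le_one (by positivity)]
      linarith) (by
      intro x hx
      have hx : 1 / 30 ≤ ∑ i ∈ Finset.range N, q Mdl σ i x := by simpa [s] using hx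
      have h1 : ∑ o, w o * (if x ∈ E o then (0 : ℝ) else 1) =
          ∑ o, w o - ∑ o, w o * (if x ∈ E o then (1 : ℝ) else 0) := by
        rw [← Finset.sum_sub_distrib]
        apply Finset.sum_congr rfl
        intro o _
        split_ifs <;> ring
      rw [h1, hwsum, hcov]
      have : (1 / 30 : ℝ) / N ≤ (∑ i ∈ Finset.range N, q Mdl σ i x) / N := by gcongr
      have e : (1 / 30 : ℝ) / N = 1 / (30 * N) := by field_simp
      linarith) (30 * N * n)
  refine ⟨_, (isU_list Mdl 3 E (fun o => Er_isU Mdl σ _ _) L).mono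
    (by rw [hL]; apply le_of_eq; ring), ?_⟩
  intro x hx
  by_contra hc
  push Not at hc
  have hxs : x ∈ s := by simpa [s] using hc
  have hprod : (L.map (fun o => if x ∈ E o then (0 : ℝ) else 1)).prod = 1 := by
    apply List.prod_eq_one
    simp only [List.mem_map]
    rintro _ ⟨o, ho, rfl⟩
    rw [if_neg]
    intro h
    exact hx ⟨o, ho, h⟩
  have h1 : (1 : ℝ) ≤ ∑ y ∈ s, (L.map (fun o => if y ∈ E o then (0 : ℝ) else 1)).prod := by
    refine hprod.symm.le.trans ?_
    apply Finset.single_le_sum (f := fun y => (L.map (fun o => if y ∈ E o then (0 : ℝ) else 1)).prod)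
      _ hxs
    intro y _
    apply List.prod_nonneg
    simp only [List.mem_map]
    rintro _ ⟨o, ho, rfl⟩
    split_ifs <;> norm_num
  have h2 : (s.card : ℝ) ≤ 2 ^ n := by
    have : s.card ≤ 2 ^ n := by
      refine (Finset.card_le_univ s).trans ?_
      simp
    exact_mod_cast this
  have h3 : (1 - 1 / (30 * N) : ℝ) ^ (30 * N * n) ≤ Real.exp (-1) ^ n := by
    rw [pow_mul]
    apply pow_le_pow_left₀
    · apply pow_nonneg
      have : (1 : ℝ) ≤ N := by exact_mod_cast hNpos
      rw [sub_nonneg, div_le_one (by positivity)]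
      linarith
    · have h4 : (1 - 1 / (30 * N) : ℝ) ≤ Real.exp (-(1 / (30 * N))) := by
        have := Real.add_one_le_exp (-(1 / (30 * N) : ℝ))
        linarith
      calc (1 - 1 / (30 * N) : ℝ) ^ (30 * N) ≤ Real.exp (-(1 / (30 * N))) ^ (30 * N) := by
            apply pow_le_pow_left₀ _ h4
            have : (1 : ℝ) ≤ N := by exact_mod_cast hNpos
            rw [sub_nonneg, div_le_one (by positivity)]
            linarith
        _ = Real.exp (-1) := by
            rw [← Real.exp_nat_mul]
            congr 1
            push_cast
            field_simp
  have h5 : Real.exp (-1) < 1 / 2 := by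
    rw [Real.exp_neg, inv_eq_one_div]
    apply one_div_lt_one_div_of_lt (by norm_num)
    have := Real.exp_one_gt_d9
    linarith
  have h6 : Real.exp (-1) ^ n < (1 / 2) ^ n :=
    pow_lt_pow_left₀ h5 (Real.exp_pos _).le hn.ne'
  have h7 : (1 - 1 / (30 * N) : ℝ) ^ (30 * N * n) * s.card < 1 := by
    calc _ ≤ Real.exp (-1) ^ n * 2 ^ n := by
          apply mul_le_mul h3 h2 (by positivity) (by positivity)
      _ < (1 / 2) ^ n * 2 ^ n := by gcongr
      _ = 1 := by rw [← mul_pow]; norm_num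
  linarith

lemma prod_pow_count {Ω : Type*} (p : Ω → Prop) [DecidablePred p] (L : List Ω) :
    (L.map (fun o => if p o then (16 : ℝ) else 1)).prod =
      16 ^ (L.map (fun o => (decide (p o)).toNat)).sum := by
  induction L with
  | nil => simp
  | cons o L ih =>
    simp only [List.map_cons, List.prod_cons, List.sum_cons, ih, pow_add]
    by_cases h : p o <;> simp [h]

/-- Stage 2 selection. -/
lemma stage2 (hN : Mdl.NegExact) (σ : ℕ → Fin n) (N : ℕ) (F : T N) :
    ∃ L : List (T N), L.length = n + 1 ∧
      ∀ x, ∑ i ∈ Finset.range N, q Mdl σ i x < 1 / 30 →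
      2 * (L.map (fun h => (decide (Bool.xor ((A Mdl σ N (xorT N F h)).1 x) ((A Mdl σ N h).1 x)
          ≠ ev σ N F x)).toNat)).sum < n + 1 := by
  have hcard : (0 : ℝ) < Fintype.card (T N) := by exact_mod_cast Fintype.card_pos
  let p : (Fin n → Bool) → T N → Prop := fun x h =>
    Bool.xor ((A Mdl σ N (xorT N F h)).1 x) ((A Mdl σ N h).1 x) ≠ ev σ N F x
  let s : Finset (Fin n → Bool) :=
    Finset.univ.filter (fun x => ∑ i ∈ Finset.range N, q Mdl σ i x < 1 / 30)
  have hwsum : ∑ _h : T N, (1 : ℝ) / Fintype.card (T N) = 1 := by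
    simp only [Finset.sum_const, Finset.card_univ, nsmul_eq_mul]
    field_simp
  have hpr : ∀ x, ∑ h : T N, (1 : ℝ) / Fintype.card (T N) * (if p x h then 1 else 0) ≤
      2 * bad Mdl σ N x := by
    intro x
    let B : T N → ℝ := fun t => if (A Mdl σ N t).1 x ≠ ev σ N t x then (1 : ℝ) else 0
    have hbij : ∑ h : T N, B (xorT N F h) = ∑ h : T N, B h :=
      Function.Bijective.sum_comp
        (Function.Involutive.bijective (f := xorT N F) (xorT_invol N F)) B
    have hle : ∀ h, (if p x h then (1 : ℝ) else 0) ≤ B (xorT N F h) + B h := by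
      intro h
      simp only [B, p]
      by_cases h1 : (A Mdl σ N (xorT N F h)).1 x = ev σ N (xorT N F h) x
      · by_cases h2 : (A Mdl σ N h).1 x = ev σ N h x
        · rw [if_neg]
          · simp [h1, h2]
          · rw [h1, h2, ev_xor]
            simp
        · rw [if_pos (c := (A Mdl σ N h).1 x ≠ ev σ N h x) h2]
          split_ifs <;> norm_num
      · rw [if_pos (c := (A Mdl σ N (xorT N F h)).1 x ≠ ev σ N (xorT N F h) x) h1]
        split_ifs <;> norm_num
    rw [← Finset.mul_sum]
    have := Finset.sum_le_sum (s := Finset.univ) (fun h _ => hle h)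
    rw [Finset.sum_add_distrib, hbij] at this
    have e : bad Mdl σ N x = (∑ h, B h) / Fintype.card (T N) := rfl
    rw [e]
    calc _ ≤ (1 : ℝ) / Fintype.card (T N) * (∑ h, B h + ∑ h, B h) := by gcongr
      _ = _ := by ring
  obtain ⟨L, hL, hS⟩ := greedy s (fun _ : T N => (1 : ℝ) / Fintype.card (T N))
    (fun o => by positivity) hwsum (fun h x => if p x h then (16 : ℝ) else 1)
    (by intro o y; split_ifs <;> norm_num) 2 (by norm_num) (by
      intro x hx
      have hx : ∑ i ∈ Finset.range N, q Mdl σ i x < 1 / 30 := by simpa [s] using hx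
      have h1 : ∑ h : T N, (1 : ℝ) / Fintype.card (T N) * (if p x h then (16 : ℝ) else 1) =
          ∑ _h : T N, (1 : ℝ) / Fintype.card (T N) +
          15 * ∑ h : T N, (1 : ℝ) / Fintype.card (T N) * (if p x h then 1 else 0) := by
        rw [Finset.mul_sum, ← Finset.sum_add_distrib]
        apply Finset.sum_congr rfl
        intro o _
        split_ifs <;> ring
      rw [h1, hwsum]
      have := hpr x
      have := bad_le Mdl hN σ x N
      linarith) (n + 1)
  refine ⟨L, hL, ?_⟩
  intro x hx
  have hxs : x ∈ s := by simpa [s] using hx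
  have h1 : (16 : ℝ) ^ (L.map (fun h => (decide (p x h)).toNat)).sum ≤
      ∑ y ∈ s, (L.map (fun o => if p y o then (16 : ℝ) else 1)).prod := by
    refine (prod_pow_count (p x) L).symm.le.trans ?_
    apply Finset.single_le_sum
      (f := fun y => (L.map (fun o => if p y o then (16 : ℝ) else 1)).prod) _ hxs
    intro y _
    apply List.prod_nonneg
    simp only [List.mem_map]
    rintro _ ⟨o, ho, rfl⟩
    split_ifs <;> norm_num
  have h2 : (s.card : ℝ) ≤ 2 ^ n := by
    have : s.card ≤ 2 ^ n := by
      refine (Finset.card_le_univ s).trans ?_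
      simp
    exact_mod_cast this
  have h3 : (2 : ℝ) ^ (4 * (L.map (fun h => (decide (p x h)).toNat)).sum) ≤ 2 ^ (2 * n + 1) := by
    rw [pow_mul]
    calc _ = (16 : ℝ) ^ (L.map (fun h => (decide (p x h)).toNat)).sum := by norm_num
      _ ≤ 2 ^ (n + 1) * s.card := h1.trans hS
      _ ≤ 2 ^ (n + 1) * 2 ^ n := by gcongr
      _ = _ := by rw [← pow_add]; congr 1; omega
  have h4 := (pow_le_pow_iff_right₀ (by norm_num : (1 : ℝ) < 2)).1 h3
  change 2 * (L.map (fun h => (decide (p x h)).toNat)).sum < n + 1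
  omega

lemma count_lem {Ω : Type*} (v : Ω → Bool) (b : Bool) (L : List Ω) :
    (b = false → (L.map (fun o => (v o).toNat)).sum
      = (L.map (fun o => (decide (v o ≠ b)).toNat)).sum) ∧
    (b = true → (L.map (fun o => (v o).toNat)).sum
      + (L.map (fun o => (decide (v o ≠ b)).toNat)).sum = L.length) := by
  induction L with
  | nil => simp
  | cons o L ih =>
    constructor
    · rintro rfl
      have := ih.1 rfl
      simp only [List.map_cons, List.sum_cons, this]
      cases v o <;> simp
    · rintro rfl
      have := ih.2 rfl
      simp only [List.map_cons, List.sum_cons, List.length_cons]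
      cases h : v o <;> simp at this ⊢ <;> omega

lemma main_big (hN : Mdl.NegExact) (σ : ℕ → Fin n) (N : ℕ) (hNpos : 0 < N) (hn : 0 < n)
    (hlt : n < 2 ^ N) (F : T N) :
    ∃ U, IsU Mdl (200 * N * n) U ∧ Rep Mdl U (ev σ N F) := by
  obtain ⟨U1, hU1, hgood⟩ := stage1 Mdl σ N hNpos hn
  obtain ⟨L, hL, hmaj⟩ := stage2 Mdl hN σ N F
  let ps : List (BF n × BF n) :=
    L.map (fun h => ((A Mdl σ N (xorT N F h)).1, (A Mdl σ N h).1))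
  obtain ⟨U2, hU2, hx⟩ := xorList hN ps (U := U1) (by
    intro p hp
    simp only [ps, List.mem_map] at hp
    obtain ⟨h, _, rfl⟩ := hp
    exact ⟨⟨_, fun _ _ => rfl⟩, ⟨_, fun _ _ => rfl⟩⟩)
  let v : T N → BF n := fun h x => Bool.xor ((A Mdl σ N (xorT N F h)).1 x) ((A Mdl σ N h).1 x)
  let th := (n + 2) / 2
  obtain ⟨U3, hU3, hc⟩ := counter hN (N + 1) (L.map v) (U := U1 ∪ U2)
    (fun _ => 2 ^ N - th) (fun i _ => ⟨constM Mdl _, fun _ _ => rfl⟩) (by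
      intro w hw
      simp only [List.mem_map] at hw
      obtain ⟨h, hh, rfl⟩ := hw
      exact hx ((A Mdl σ N (xorT N F h)).1, (A Mdl σ N h).1) (List.mem_map.2 ⟨h, hh, rfl⟩))
  refine ⟨U1 ∪ U2 ∪ U3, ((hU1.union hU2).union hU3).mono ?_, ?_⟩
  · simp only [ps, List.length_map, hL]
    have : N * 1 ≤ N * n := Nat.mul_le_mul_left N hn
    have : 1 * n ≤ N * n := Nat.mul_le_mul_right n hNpos
    ring_nf
    ring_nf at *
    omega
  · obtain ⟨g, hg⟩ := hc N (by omega)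
    refine ⟨g, fun x hxU => ?_⟩
    rw [hg x hxU]
    have hx1 : x ∉ U1 := fun h => hxU (by simp [h])
    have hm := hmaj x (hgood x hx1)
    have hcnt := count_lem (fun h => v h x) (ev σ N F x) L
    simp only [List.map_map]
    change decide ((2 ^ N - th + (L.map (fun h => (v h x).toNat)).sum) / 2 ^ N % 2 = 1) = _
    change 2 * (L.map (fun h => (decide (v h x ≠ ev σ N F x)).toNat)).sum < n + 1 at hm
    generalize (L.map (fun h => (decide (v h x ≠ ev σ N F x)).toNat)).sum = W at *
    generalize (L.map (fun h => (v h x).toNat)).sum = C at *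
    have hth : th = (n + 2) / 2 := rfl
    rw [hL] at hcnt
    cases hb : ev σ N F x
    · have := hcnt.1 hb
      have h0 : (2 ^ N - th + C) / 2 ^ N = 0 := Nat.div_eq_of_lt (by omega)
      rw [h0]; rfl
    · have := hcnt.2 hb
      have h0 : (2 ^ N - th + C) / 2 ^ N = 1 := by
        rw [Nat.div_eq_iff (by positivity)]
        omega
      rw [h0]; rfl

lemma rho_le {f : BF n} {k : ℕ} {U : Set (Fin n → Bool)} (hU : IsU Mdl k U)
    (h : Rep Mdl U f) : Mdl.rho f ≤ (k : ℕ∞) := by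
  obtain ⟨L, h1, h2, h3⟩ := hU
  obtain ⟨g, hg⟩ := h
  refine le_trans (sInf_le ⟨L.length, rfl, g.1, g.2, fun i => L.get i, ?_, ?_⟩)
    (by exact_mod_cast h1)
  · intro i
    exact h2 _ (List.get_mem _ _)
  · intro x hx
    have : x ∈ U := by
      by_contra hc
      exact hx (hg x hc).symm
    obtain ⟨δ, hδ, hxδ⟩ := h3 x this
    obtain ⟨i, rfl⟩ := List.get_of_mem hδ
    exact ⟨i, hxδ⟩

lemma exists_tree (f : BF n) (hpos : 0 < essCount f) :
    ∃ (σ : ℕ → Fin n) (F : T (essCount f)), ev σ (essCount f) F = f := by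
  let J : Finset (Fin n) := Finset.univ.filter (fun i => Essential f i)
  have hJ : essCount f = J.card := by
    rw [essCount, ← Set.ncard_coe_finset]
    congr 1
    ext i
    simp [J]
  have hne : J.Nonempty := by
    rw [← Finset.card_pos]; omega
  obtain ⟨i0, hi0⟩ := hne
  let σ : ℕ → Fin n := fun i => J.toList.getD i i0
  refine ⟨σ, exists_ev σ _ f ?_⟩
  intro x y hxy
  apply dep_ess f (Finset.univ.filter (fun i => ¬ Essential f i)) (by simp)
  intro i hi
  have hi : i ∈ J := by simpa [J] using hi
  obtain ⟨j, hj, rfl⟩ := List.getElem_of_mem (Finset.mem_toList.2 hi)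
  have h := hxy j (by rw [hJ, ← Finset.length_toList]; exact hj)
  have e : σ j = J.toList[j] := by simp only [σ]; exact List.getD_eq_getElem _ _ hj
  rwa [e] at h

end Stmt2Aux

open Stmt2Aux in
theorem stmt2 :
    ∃ K : ℕ, ∀ (n : ℕ) (Mdl : LegitModel n S3), Mdl.NegExact →
      ∀ f : BF n, Mdl.rho f ≤ ((K * essCount f * n : ℕ) : ℕ∞) := by
  refine ⟨200, fun n Mdl hN f => ?_⟩
  rcases Nat.eq_zero_or_pos (essCount f) with h0 | hpos
  · have hconst : ∀ x, f x = f (fun _ => false) := by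
      intro x
      have hno : ∀ i, ¬ Essential f i := by
        intro i hi
        have := (Set.ncard_eq_zero (Set.toFinite _)).1 h0
        exact (Set.eq_empty_iff_forall_notMem.1 this) i hi
      exact dep_ess f Finset.univ (fun i _ => hno i) _ _ (by simp)
    exact rho_le Mdl ((IsU.empty Mdl).mono (Nat.zero_le _))
      ⟨constM Mdl (f (fun _ => false)), fun x _ => (hconst x).symm⟩
  · obtain ⟨σ, F, hF⟩ := exists_tree f hpos
    have hn : 0 < n := (σ 0).pos
    rcases Nat.lt_or_ge n (2 ^ essCount f) with hlt | hge
    · obtain ⟨U, hU, hR⟩ := main_big Mdl hN σ _ hpos hn hlt F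
      rw [hF] at hR
      exact rho_le Mdl hU hR
    · obtain ⟨U, hU, hR⟩ := tree_rep Mdl hN σ _ F
      rw [hF] at hR
      refine rho_le Mdl (hU.mono ?_) ⟨_, hR⟩
      have : 1 * n ≤ essCount f * n := Nat.mul_le_mul_right n hpos
      rw [mul_assoc]
      omega

end
end

section
/- For every n, every legitimate model ℳ of order n of the class of Boolean circuits over {¬, ∧₂, ∨₂} with ¬̄ := ¬, every f ∈ ℱ_n with n₀ essential variables, and every random variable 𝐱 on {0,1}^n with d := max_{δ∈Δ} Pr[𝐱 ∈ δ] ≠ 0, one has ρ(f, ℳ, 𝐱) ≤ 12(n₀ + 1). -/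
open scoped Classical ENNReal

noncomputable section

namespace Stmt3Aux

/-- Decision trees of depth `k`. -/
def T : ℕ → Type
  | 0 => Bool
  | k + 1 => T k × T k

instance instFT : (k : ℕ) → Fintype (T k)
  | 0 => inferInstanceAs (Fintype Bool)
  | k + 1 => @instFintypeProd (T k) (T k) (instFT k) (instFT k)

instance instNE : (k : ℕ) → Nonempty (T k)
  | 0 => ⟨(true : Bool)⟩
  | k + 1 => ⟨((instNE k).some, (instNE k).some)⟩

def ev {n : ℕ} : (l : List (Fin n)) → T l.length → (Fin n → Bool) → Bool
  | [], t, _ => (show Bool from t)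
  | i :: l, t, x => if x i then ev l t.2 x else ev l t.1 x

def tx : (k : ℕ) → T k → T k → T k
  | 0, a, b => Bool.xor a b
  | k + 1, a, b => (tx k a.1 b.1, tx k a.2 b.2)

lemma tx_tx : ∀ (k : ℕ) (a b : T k), tx k a (tx k a b) = b
  | 0, a, b => by
    change Bool at a b
    change (Bool.xor a (Bool.xor a b) = b)
    cases a <;> cases b <;> rfl
  | k + 1, a, b => Prod.ext (tx_tx k _ _) (tx_tx k _ _)

lemma ev_tx {n : ℕ} : ∀ (l : List (Fin n)) (a b : T l.length) (x : Fin n → Bool),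
    ev l (tx l.length a b) x = Bool.xor (ev l a x) (ev l b x)
  | [], a, b, x => rfl
  | i :: l, a, b, x => by
    have h1 := ev_tx l a.1 b.1 x
    have h2 := ev_tx l a.2 b.2 x
    change (if x i then ev l (tx l.length a.2 b.2) x else ev l (tx l.length a.1 b.1) x) =
      Bool.xor (if x i then ev l a.2 x else ev l a.1 x) (if x i then ev l b.2 x else ev l b.1 x)
    split_ifs
    · exact h2
    · exact h1

lemma ev_surj {n : ℕ} : ∀ (l : List (Fin n)) (f : BF n),
    (∀ x y : Fin n → Bool, (∀ i ∈ l, x i = y i) → f x = f y) →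
    ∃ t : T l.length, ∀ x, ev l t x = f x
  | [], f, h => ⟨f (fun _ => false), fun x => h _ _ (by simp)⟩
  | i :: l, f, h => by
    have key : ∀ b : Bool, ∃ t : T l.length, ∀ x, ev l t x = f (Function.update x i b) := by
      intro b
      refine ev_surj l (fun x => f (Function.update x i b)) ?_
      intro x y hxy
      apply h
      intro j hj
      by_cases hji : j = i
      · subst hji; simp
      · simp only [Function.update_of_ne hji]
        exact hxy j (by simpa [hji] using hj)
    obtain ⟨t0, h0⟩ := key false
    obtain ⟨t1, h1⟩ := key true
    refine ⟨(t0, t1), fun x => ?_⟩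
    change (if x i then ev l t1 x else ev l t0 x) = f x
    split_ifs with hx
    · rw [h1, ← hx, Function.update_eq_self]
    · have hx' : x i = false := by simpa using hx
      rw [h0, ← hx', Function.update_eq_self]

lemma ess_dep {n : ℕ} (f : BF n) (x y : Fin n → Bool)
    (h : ∀ i, Essential f i → x i = y i) : f x = f y := by
  have key : ∀ s : Finset (Fin n), f (fun i => if i ∈ s then y i else x i) = f x := by
    intro s
    induction s using Finset.induction_on with
    | empty => simp
    | insert a s ha ih =>
      rw [← ih]
      by_cases hxy : x a = y a
      · congr 1
        funext i
        by_cases hi : i = a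
        · subst hi; simp [ha, hxy]
        · simp [hi]
      · have hne : ¬ Essential f a := fun he => hxy (h a he)
        unfold Essential at hne
        push Not at hne
        rw [← hne (fun i => if i ∈ s then y i else x i)]
        congr 1
        funext i
        by_cases hi : i = a
        · subst hi
          simp only [Finset.mem_insert_self, if_true, Function.update_self, ha, if_false]
          revert hxy
          cases x i <;> cases y i <;> simp
        · simp [hi]
  have := key Finset.univ
  simpa using this.symm

section pr
variable {n : ℕ} {p : (Fin n → Bool) → ℝ} (hp : ∀ x, 0 ≤ p x)
include hp

lemma pr_nonneg (A : Set (Fin n → Bool)) : 0 ≤ prOf p A :=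
  Finset.sum_nonneg fun x _ => Set.indicator_nonneg (fun x _ => hp x) x

lemma pr_mono {A B : Set (Fin n → Bool)} (h : A ⊆ B) : prOf p A ≤ prOf p B :=
  Finset.sum_le_sum fun x _ => Set.indicator_le_indicator_of_subset h hp x

lemma pr_union (A B : Set (Fin n → Bool)) : prOf p (A ∪ B) ≤ prOf p A + prOf p B := by
  unfold prOf
  rw [← Finset.sum_add_distrib]
  refine Finset.sum_le_sum fun x _ => ?_
  have := hp x
  by_cases ha : x ∈ A <;> by_cases hb : x ∈ B <;> simp [ha, hb, this]

end pr

lemma pr_split {n : ℕ} {p : (Fin n → Bool) → ℝ} (i : Fin n) (A : Set (Fin n → Bool)) :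
    prOf p {x | x i = false ∧ x ∈ A} + prOf p {x | x i = true ∧ x ∈ A} = prOf p A := by
  unfold prOf
  rw [← Finset.sum_add_distrib]
  refine Finset.sum_congr rfl fun x _ => ?_
  by_cases ha : x ∈ A <;> cases hx : x i <;> simp [ha, hx, Set.indicator]

section model
variable {n : ℕ} (Mdl : LegitModel n S3) (hneg : Mdl.NegExact)
  {p : (Fin n → Bool) → ℝ} {d : ℝ} (hp : ∀ x, 0 ≤ p x)
  (hd : ∀ δ ∈ Mdl.Delta, prOf p δ ≤ d)

lemma neg_mem (hneg : Mdl.NegExact) {g : BF n} (hg : g ∈ Mdl.M) : (fun x => !(g x)) ∈ Mdl.M := by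
  have hc : notConn ∈ S3 := by simp [S3]
  have := hneg hc (fun _ => ⟨g, hg⟩)
  simp only at this
  rw [← this]
  exact Subtype.property _

lemma and_app (hd : ∀ δ ∈ Mdl.Delta, prOf p δ ≤ d) {a b : BF n} (ha : a ∈ Mdl.M)
    (hb : b ∈ Mdl.M) : ∃ g ∈ Mdl.M, prOf p {x | (a x && b x) ≠ g x} ≤ d := by
  have hc : andConn ∈ S3 := by simp [S3]
  exact ⟨_, (Mdl.approx andConn hc ![⟨a, ha⟩, ⟨b, hb⟩]).2,
    hd _ ⟨andConn, hc, ![⟨a, ha⟩, ⟨b, hb⟩], rfl⟩⟩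

lemma or_app (hd : ∀ δ ∈ Mdl.Delta, prOf p δ ≤ d) {a b : BF n} (ha : a ∈ Mdl.M)
    (hb : b ∈ Mdl.M) : ∃ g ∈ Mdl.M, prOf p {x | (a x || b x) ≠ g x} ≤ d := by
  have hc : orConn ∈ S3 := by simp [S3]
  exact ⟨_, (Mdl.approx orConn hc ![⟨a, ha⟩, ⟨b, hb⟩]).2,
    hd _ ⟨orConn, hc, ![⟨a, ha⟩, ⟨b, hb⟩], rfl⟩⟩

lemma mux_app (hneg : Mdl.NegExact) (hp : ∀ x, 0 ≤ p x) (hd : ∀ δ ∈ Mdl.Delta, prOf p δ ≤ d)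
    {a b c : BF n} (ha : a ∈ Mdl.M) (hb : b ∈ Mdl.M) (hc : c ∈ Mdl.M) :
    ∃ g ∈ Mdl.M, prOf p {x | (if a x then b x else c x) ≠ g x} ≤ 3 * d := by
  obtain ⟨u, hu, hu'⟩ := and_app Mdl hd ha hb
  obtain ⟨v, hv, hv'⟩ := and_app Mdl hd (neg_mem Mdl hneg ha) hc
  obtain ⟨w, hw, hw'⟩ := or_app Mdl hd hu hv
  refine ⟨w, hw, ?_⟩
  have hsub : {x | (if a x then b x else c x) ≠ w x} ⊆
      {x | (a x && b x) ≠ u x} ∪ ({x | (!(a x) && c x) ≠ v x} ∪ {x | (u x || v x) ≠ w x}) := by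
    intro x hx
    simp only [Set.mem_union, Set.mem_ofPred_eq] at hx ⊢
    by_contra hcon
    push Not at hcon
    obtain ⟨h1, h2, h3⟩ := hcon
    apply hx
    rw [← h3, ← h1, ← h2]
    cases a x <;> simp
  have h1 := pr_mono hp hsub
  have h2 := pr_union hp {x | (a x && b x) ≠ u x}
    ({x | (!(a x) && c x) ≠ v x} ∪ {x | (u x || v x) ≠ w x})
  have h3 := pr_union hp {x | (!(a x) && c x) ≠ v x} {x | (u x || v x) ≠ w x}
  linarith

lemma main_app (hneg : Mdl.NegExact) (hp : ∀ x, 0 ≤ p x) (hd : ∀ δ ∈ Mdl.Delta, prOf p δ ≤ d)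
    (hd0 : 0 ≤ d) :
    ∀ l : List (Fin n), ∃ A : T l.length → BF n, (∀ t, A t ∈ Mdl.M) ∧
      ∑ t, prOf p {x | ev l t x ≠ A t x} ≤ (Fintype.card (T l.length) : ℝ) * (3 * l.length * d)
  | [] => by
    refine ⟨fun t _ => (show Bool from t), fun t => Mdl.const_mem _, ?_⟩
    have : ∀ t : T ([] : List (Fin n)).length,
        prOf p {x | ev ([] : List (Fin n)) t x ≠ (show Bool from t)} = 0 := by
      intro t
      refine Finset.sum_eq_zero fun x _ => Set.indicator_of_notMem ?_ p
      intro hx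
      exact hx rfl
    simp only [this]
    simp
  | i :: l => by
    obtain ⟨A, hA, hs⟩ := main_app hneg hp hd hd0 l
    have hm := fun t : T l.length × T l.length =>
      mux_app Mdl hneg hp hd (Mdl.var_mem i) (hA t.2) (hA t.1)
    choose B hB hB' using hm
    refine ⟨B, hB, ?_⟩
    set E : T l.length → Set (Fin n → Bool) := fun t => {x | ev l t x ≠ A t x} with hE
    have hpt : ∀ t : T l.length × T l.length, prOf p {x | ev (i :: l) t x ≠ B t x} ≤
        3 * d + (prOf p {x | x i = false ∧ x ∈ E t.1} + prOf p {x | x i = true ∧ x ∈ E t.2}) := by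
      intro t
      have hsub : {x | ev (i :: l) t x ≠ B t x} ⊆
          {x | (if x i then A t.2 x else A t.1 x) ≠ B t x} ∪
          ({x | x i = false ∧ x ∈ E t.1} ∪ {x | x i = true ∧ x ∈ E t.2}) := by
        intro x hx
        change (if x i then ev l t.2 x else ev l t.1 x) ≠ B t x at hx
        simp only [Set.mem_union, Set.mem_ofPred_eq, hE]
        cases hxi : x i
        · simp only [hxi] at hx ⊢
          by_cases h : ev l t.1 x = A t.1 x
          · left; simpa [h] using hx
          · right; left; exact ⟨trivial, h⟩
        · simp only [hxi] at hx ⊢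
          by_cases h : ev l t.2 x = A t.2 x
          · left; simpa [h] using hx
          · right; right; exact ⟨trivial, h⟩
      have h1 := pr_mono hp hsub
      have h2 := pr_union hp {x | (if x i then A t.2 x else A t.1 x) ≠ B t x}
        ({x | x i = false ∧ x ∈ E t.1} ∪ {x | x i = true ∧ x ∈ E t.2})
      have h3 := pr_union hp {x | x i = false ∧ x ∈ E t.1} {x | x i = true ∧ x ∈ E t.2}
      have h4 := hB' t
      linarith
    have hcard : (Fintype.card (T (i :: l).length) : ℝ) =
        (Fintype.card (T l.length) : ℝ) * (Fintype.card (T l.length) : ℝ) := by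
      have : Fintype.card (T (i :: l).length) = Fintype.card (T l.length × T l.length) := rfl
      rw [this, Fintype.card_prod]; push_cast; rfl
    set N : ℝ := (Fintype.card (T l.length) : ℝ) with hN
    have hsum : ∑ t : T l.length × T l.length, (3 * d + (prOf p {x | x i = false ∧ x ∈ E t.1}
        + prOf p {x | x i = true ∧ x ∈ E t.2})) = N * N * (3 * d) + N * ∑ t, prOf p (E t) := by
      rw [Finset.sum_add_distrib, Finset.sum_add_distrib, Fintype.sum_prod_type,
        Fintype.sum_prod_type, Fintype.sum_prod_type]
      simp only [Finset.sum_const, Finset.card_univ, nsmul_eq_mul, ← Finset.mul_sum]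
      rw [← hN, ← mul_add, ← Finset.sum_add_distrib]
      simp only [pr_split]
      ring
    have hfin : ∑ t : T l.length × T l.length, prOf p {x | ev (i :: l) t x ≠ B t x} ≤
        N * N * (3 * d) + N * ∑ t, prOf p (E t) := by
      rw [← hsum]
      exact Finset.sum_le_sum fun t _ => hpt t
    have hN0 : 0 ≤ N := Nat.cast_nonneg _
    have hmul := mul_le_mul_of_nonneg_left hs hN0
    rw [hcard]
    refine le_trans hfin ?_
    have hlen : ((i :: l).length : ℝ) = l.length + 1 := by simp
    rw [hlen]
    linarith

end model

end Stmt3Aux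

open Stmt3Aux in
theorem stmt3 {n : ℕ} (Mdl : LegitModel n S3) (hneg : Mdl.NegExact)
    (f : BF n) (p : (Fin n → Bool) → ℝ) (d : ℝ)
    (hp : IsDistrib p)
    (hd : IsGreatest {r : ℝ | ∃ δ ∈ Mdl.Delta, r = prOf p δ} d)
    (hd0 : d ≠ 0) :
    Mdl.rhoProb f p d ≤ 12 * (essCount f + 1) := by
  obtain ⟨hp0, -⟩ := hp
  have hdn : 0 ≤ d := by
    obtain ⟨δ, -, h⟩ := hd.1
    rw [h]; exact pr_nonneg hp0 δ
  have hdpos : 0 < d := lt_of_le_of_ne hdn (Ne.symm hd0)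
  have hd' : ∀ δ ∈ Mdl.Delta, prOf p δ ≤ d := fun δ hδ => hd.2 ⟨δ, hδ, rfl⟩
  set l : List (Fin n) := (Finset.univ.filter (fun i => Essential f i)).toList with hl
  have hlen : l.length = essCount f := by
    rw [hl, Finset.length_toList, essCount, Set.ncard_eq_toFinset_card']
    congr 1
    ext i; simp
  obtain ⟨t, ht⟩ := ev_surj l f (fun x y hxy => ess_dep f x y (fun i hi => hxy i (by simp [hl, hi])))
  obtain ⟨A, hA, hs⟩ := main_app Mdl hneg hp0 hd' hdn l
  set F : T l.length → ℝ := fun s => prOf p {x | ev l s x ≠ A s x} with hF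
  let e : T l.length ≃ T l.length := ⟨tx _ t, tx _ t, tx_tx _ t, tx_tx _ t⟩
  have hs2 : ∑ s, F (tx _ t s) = ∑ s, F s := Equiv.sum_comp e F
  have hex : ∃ s ∈ Finset.univ, F s + F (tx _ t s) ≤ 6 * l.length * d := by
    apply Finset.exists_le_of_sum_le (Finset.univ_nonempty)
    rw [Finset.sum_add_distrib, hs2]
    simp only [Finset.sum_const, Finset.card_univ, nsmul_eq_mul]
    linarith
  obtain ⟨s, -, hs3⟩ := hex
  obtain ⟨g, hg, hg'⟩ := mux_app Mdl hneg hp0 hd' (hA s)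
    (neg_mem Mdl hneg (hA (tx _ t s))) (hA (tx _ t s))
  have hsub : {x | f x ≠ g x} ⊆
      {x | (if A s x then !(A (tx _ t s) x) else A (tx _ t s) x) ≠ g x} ∪
      ({x | ev l s x ≠ A s x} ∪ {x | ev l (tx _ t s) x ≠ A (tx _ t s) x}) := by
    intro x hx
    simp only [Set.mem_union, Set.mem_ofPred_eq] at hx ⊢
    by_contra hcon
    push Not at hcon
    obtain ⟨h1, h2, h3⟩ := hcon
    apply hx
    rw [← h1, ← h2, ← h3, ev_tx, ← ht x]
    cases ev l s x <;> cases ev l t x <;> rfl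
  have h1 := pr_mono hp0 hsub
  have h2 := pr_union hp0 {x | (if A s x then !(A (tx _ t s) x) else A (tx _ t s) x) ≠ g x}
      ({x | ev l s x ≠ A s x} ∪ {x | ev l (tx _ t s) x ≠ A (tx _ t s) x})
  have h3 := pr_union hp0 {x | ev l s x ≠ A s x} {x | ev l (tx _ t s) x ≠ A (tx _ t s) x}
  have hbound : prOf p {x | f x ≠ g x} / d ≤ 12 * (essCount f + 1) := by
    rw [div_le_iff₀ hdpos, ← hlen]
    have : 0 ≤ (l.length : ℝ) * d := by positivity
    simp only [hF] at hs3
    nlinarith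
  refine le_trans (csInf_le ⟨0, ?_⟩ ⟨g, hg, rfl⟩) hbound
  rintro r ⟨g', -, rfl⟩
  exact div_nonneg (pr_nonneg hp0 _) hdn

end
end

section
/- For every n, every legitimate model ℳ of order n of the class of Boolean circuits over {¬, ∧₂, ∨₂} with ¬̄ := ¬, and every f ∈ ℱ_n with n₀ essential variables, there exist a random variable 𝛅 taking values in Δ and a random variable 𝐡 taking values in ℳ such that for every x ∈ {0,1}^n: Pr[𝐡(x) ≠ f(x)] ≤ 12(n₀ + 1) · Pr[x ∈ 𝛅]. -/
open scoped Classical ENNReal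

noncomputable section

/-- `e` is dominated by a nonnegative combination of total weight `c` of error sets. -/
def GoodW {n : ℕ} (Mdl : LegitModel n S3) (c : ℝ) (e : (Fin n → Bool) → ℝ) : Prop :=
  ∃ w : Mdl.Delta → ℝ, (∀ d, 0 ≤ w d) ∧ (∑ d, w d) = c ∧
    ∀ x, e x ≤ ∑ d : Mdl.Delta, if x ∈ d.1 then w d else 0

lemma GoodW.mono {n : ℕ} {Mdl : LegitModel n S3} {c : ℝ} {e e' : (Fin n → Bool) → ℝ}
    (h : GoodW Mdl c e) (he : ∀ x, e' x ≤ e x) : GoodW Mdl c e' := by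
  obtain ⟨w, h1, h2, h3⟩ := h
  exact ⟨w, h1, h2, fun x => (he x).trans (h3 x)⟩

lemma GoodW.zero {n : ℕ} (Mdl : LegitModel n S3) : GoodW Mdl 0 (fun _ => 0) :=
  ⟨fun _ => 0, by simp, by simp, by simp⟩

lemma GoodW.add {n : ℕ} {Mdl : LegitModel n S3} {c c' : ℝ} {e e' : (Fin n → Bool) → ℝ}
    (h : GoodW Mdl c e) (h' : GoodW Mdl c' e') : GoodW Mdl (c + c') (fun x => e x + e' x) := by
  obtain ⟨w, h1, h2, h3⟩ := h
  obtain ⟨w', h1', h2', h3'⟩ := h'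
  refine ⟨fun d => w d + w' d, fun d => add_nonneg (h1 d) (h1' d), ?_, fun x => ?_⟩
  · rw [Finset.sum_add_distrib, h2, h2']
  · refine (add_le_add (h3 x) (h3' x)).trans (le_of_eq ?_)
    rw [← Finset.sum_add_distrib]
    refine Finset.sum_congr rfl fun d _ => ?_
    split_ifs <;> simp

lemma GoodW.smul {n : ℕ} {Mdl : LegitModel n S3} {c r : ℝ} {e : (Fin n → Bool) → ℝ}
    (h : GoodW Mdl c e) (hr : 0 ≤ r) : GoodW Mdl (r * c) (fun x => r * e x) := by
  obtain ⟨w, h1, h2, h3⟩ := h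
  refine ⟨fun d => r * w d, fun d => mul_nonneg hr (h1 d), ?_, fun x => ?_⟩
  · rw [← Finset.mul_sum, h2]
  · refine (mul_le_mul_of_nonneg_left (h3 x) hr).trans (le_of_eq ?_)
    rw [Finset.mul_sum]
    refine Finset.sum_congr rfl fun d _ => ?_
    split_ifs <;> simp

lemma GoodW.single {n : ℕ} {Mdl : LegitModel n S3} (d : Mdl.Delta) :
    GoodW Mdl 1 (fun x => if x ∈ d.1 then 1 else 0) := by
  refine ⟨fun d' => if d' = d then 1 else 0, fun d' => by dsimp only; split_ifs <;> simp, by simp,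
    fun x => ?_⟩
  have := Finset.single_le_sum (f := fun d' : Mdl.Delta =>
    if x ∈ d'.1 then (if d' = d then (1 : ℝ) else 0) else 0) (s := Finset.univ)
    (fun i _ => by split_ifs <;> simp) (Finset.mem_univ d)
  simpa using this

lemma GoodW.sum {n : ℕ} {Mdl : LegitModel n S3} {ι : Type*} (s : Finset ι) (φ : ι → Mdl.Delta) :
    GoodW Mdl s.card (fun x => ∑ i ∈ s, if x ∈ (φ i).1 then 1 else 0) := by
  induction s using Finset.induction_on with
  | empty => simpa using GoodW.zero Mdl
  | insert a s ha ih =>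
    have := (GoodW.single (φ a)).add ih
    rw [Finset.card_insert_of_notMem ha]
    push_cast
    rw [add_comm]
    refine this.mono fun x => ?_
    rw [Finset.sum_insert ha]

lemma GoodW.avg {n : ℕ} {Mdl : LegitModel n S3} {ι : Type*} [Fintype ι] [Nonempty ι]
    (φ : ι → Mdl.Delta) :
    GoodW Mdl 1 (fun x => (Fintype.card ι : ℝ)⁻¹ * ∑ i, if x ∈ (φ i).1 then 1 else 0) := by
  have := (GoodW.sum Finset.univ φ).smul (r := (Fintype.card ι : ℝ)⁻¹) (by positivity)
  rwa [Finset.card_univ, inv_mul_cancel₀ (by simp)] at this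

lemma op_and {n : ℕ} (Mdl : LegitModel n S3) (a b : Mdl.M) :
    ∃ (r : Mdl.M) (d : Mdl.Delta), ∀ x, x ∉ d.1 → r.1 x = (a.1 x && b.1 x) := by
  have hc : andConn ∈ S3 := by simp [S3]
  refine ⟨Mdl.approx andConn hc ![a, b], ⟨_, andConn, hc, ![a, b], rfl⟩, fun x hx => ?_⟩
  simp only [LegitModel.errSet, Set.mem_setOf_eq, not_not] at hx
  rw [← hx]; rfl

lemma op_or {n : ℕ} (Mdl : LegitModel n S3) (a b : Mdl.M) :
    ∃ (r : Mdl.M) (d : Mdl.Delta), ∀ x, x ∉ d.1 → r.1 x = (a.1 x || b.1 x) := by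
  have hc : orConn ∈ S3 := by simp [S3]
  refine ⟨Mdl.approx orConn hc ![a, b], ⟨_, orConn, hc, ![a, b], rfl⟩, fun x hx => ?_⟩
  simp only [LegitModel.errSet, Set.mem_setOf_eq, not_not] at hx
  rw [← hx]; rfl

lemma op_not {n : ℕ} (Mdl : LegitModel n S3) (hneg : Mdl.NegExact) (a : Mdl.M) :
    ∃ (r : Mdl.M), ∀ x, r.1 x = !(a.1 x) := by
  have hc : notConn ∈ S3 := by simp [S3]
  exact ⟨Mdl.approx notConn hc ![a], fun x => by rw [hneg]; rfl⟩

lemma op_mux {n : ℕ} (Mdl : LegitModel n S3) (a b c e : Mdl.M) :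
    ∃ (r : Mdl.M) (d : Fin 3 → Mdl.Delta), ∀ x, (∀ j, x ∉ (d j).1) →
      r.1 x = ((a.1 x && b.1 x) || (c.1 x && e.1 x)) := by
  obtain ⟨r1, d1, h1⟩ := op_and Mdl a b
  obtain ⟨r2, d2, h2⟩ := op_and Mdl c e
  obtain ⟨r3, d3, h3⟩ := op_or Mdl r1 r2
  refine ⟨r3, ![d1, d2, d3], fun x hx => ?_⟩
  rw [h3 x (hx 2), h1 x (hx 0), h2 x (hx 1)]

/-- Splitting off the first variable. -/
def splitG (k : ℕ) : BF (k + 1) ≃ BF k × BF k where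
  toFun g := (fun y => g (Fin.cons true y), fun y => g (Fin.cons false y))
  invFun p := fun y => if y 0 then p.1 (Fin.tail y) else p.2 (Fin.tail y)
  left_inv g := by
    funext y
    have h := Fin.cons_self_tail y
    by_cases h0 : y 0 = true
    · simp only [h0, if_true]; rw [h0] at h; rw [h]
    · simp only [h0]
      simp only [Bool.not_eq_true] at h0; rw [h0] at h; simp [h]
  right_inv p := by ext y <;> simp

/-- Indicator of a Boolean disagreement. -/
def ind (a b : Bool) : ℝ := if a ≠ b then 1 else 0

lemma ind_le_three {n : ℕ} {Mdl : LegitModel n S3} (d : Fin 3 → Mdl.Delta) (x : Fin n → Bool)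
    (a b : Bool) (z : ℝ) (hz : 0 ≤ z) (h : (∀ j, x ∉ (d j).1) → ind a b ≤ z) :
    ind a b ≤ (∑ j, if x ∈ (d j).1 then 1 else 0) + z := by
  by_cases hx : ∀ j, x ∉ (d j).1
  · exact (h hx).trans (le_add_of_nonneg_left (Finset.sum_nonneg fun j _ => by split_ifs <;> simp))
  · push Not at hx
    obtain ⟨j, hj⟩ := hx
    have := Finset.single_le_sum (f := fun j => if x ∈ (d j).1 then (1 : ℝ) else 0)
      (s := Finset.univ) (fun i _ => by split_ifs <;> simp) (Finset.mem_univ j)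
    simp only [hj, if_true] at this
    have h1 : ind a b ≤ 1 := by unfold ind; split_ifs <;> simp
    linarith

lemma ind_nonneg (a b : Bool) : 0 ≤ ind a b := by unfold ind; split_ifs <;> simp

lemma GoodW.three {n : ℕ} {Mdl : LegitModel n S3} {ι : Type*} [Fintype ι] [Nonempty ι]
    (D : ι → Fin 3 → Mdl.Delta) :
    GoodW Mdl 3 (fun x => (Fintype.card ι : ℝ)⁻¹ *
      ∑ i, ∑ j, if x ∈ (D i j).1 then 1 else 0) := by
  have h := ((GoodW.avg (fun i => D i 0)).add (GoodW.avg (fun i => D i 1))).add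
    (GoodW.avg (fun i => D i 2))
  rw [show (1 + 1 + 1 : ℝ) = 3 by norm_num] at h
  refine h.mono fun x => le_of_eq ?_
  simp only [Fin.sum_univ_three, Finset.sum_add_distrib, mul_add]

lemma main_rand {n : ℕ} (Mdl : LegitModel n S3) (hneg : Mdl.NegExact) :
    ∀ (k : ℕ) (σ : Fin k → Fin n), ∃ A : BF k → Mdl.M,
      GoodW Mdl (3 * k) (fun x => (Fintype.card (BF k) : ℝ)⁻¹ *
        ∑ g, ind ((A g).1 x) (g (fun i => x (σ i))))
  | 0, σ => by
    refine ⟨fun g => ⟨fun _ => g Fin.elim0, Mdl.const_mem _⟩, ?_⟩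
    have := GoodW.zero Mdl
    simp only [Nat.cast_zero, mul_zero]
    refine this.mono fun x => le_of_eq ?_
    have : ∀ g : BF 0, g (fun i => x (σ i)) = g Fin.elim0 := fun g => by
      congr 1; exact Subsingleton.elim _ _
    simp [ind, this]
  | k + 1, σ => by
    obtain ⟨A, hA⟩ := main_rand Mdl hneg k (fun i => σ i.succ)
    let v : Mdl.M := ⟨fun x => x (σ 0), Mdl.var_mem _⟩
    obtain ⟨nv, hnv⟩ := op_not Mdl hneg v
    choose r D hD using fun p : BF k × BF k => op_mux Mdl v (A p.1) nv (A p.2)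
    refine ⟨fun g => r (splitG k g), ?_⟩
    have h := (GoodW.three D).add hA
    have hc : (3 + 3 * (k : ℝ)) = 3 * ((k + 1 : ℕ) : ℝ) := by push_cast; ring
    rw [hc] at h
    refine h.mono fun x => ?_
    have e1 : ∑ g : BF (k + 1), ind ((r (splitG k g)).1 x) (g (fun i => x (σ i))) =
        ∑ p : BF k × BF k, ind ((r p).1 x)
          (if x (σ 0) then p.1 (fun i => x (σ i.succ)) else p.2 (fun i => x (σ i.succ))) := by
      rw [← Equiv.sum_comp (splitG k)]
      refine Finset.sum_congr rfl fun g _ => ?_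
      congr 1
      conv_lhs => rw [← (splitG k).symm_apply_apply g]
      rfl
    rw [e1, Fintype.card_congr (splitG k)]
    set N : ℝ := (Fintype.card (BF k) : ℝ) with hN
    have hN0 : 0 < N := by rw [hN]; exact_mod_cast Fintype.card_pos
    set S : ℝ := ∑ g : BF k, ind ((A g).1 x) (g (fun i => x (σ i.succ))) with hS
    have hcard : ((Fintype.card (BF k × BF k) : ℕ) : ℝ) = N * N := by
      rw [Fintype.card_prod]; push_cast; rfl
    have key : ∑ p : BF k × BF k, ind ((r p).1 x)
          (if x (σ 0) then p.1 (fun i => x (σ i.succ)) else p.2 (fun i => x (σ i.succ))) ≤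
        (∑ p, ∑ j, if x ∈ (D p j).1 then 1 else 0) + N * S := by
      have e2 : N * S = ∑ p : BF k × BF k, (if x (σ 0) then
          ind ((A p.1).1 x) (p.1 (fun i => x (σ i.succ))) else
          ind ((A p.2).1 x) (p.2 (fun i => x (σ i.succ)))) := by
        rw [Fintype.sum_prod_type]
        by_cases hx : x (σ 0) = true
        · simp only [hx, if_true, Finset.sum_const, Finset.card_univ, nsmul_eq_mul,
            ← Finset.mul_sum, hS, hN]
        · simp only [hx, Finset.sum_const, Finset.card_univ, nsmul_eq_mul, hS, hN]
          simp
      rw [e2, ← Finset.sum_add_distrib]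
      refine Finset.sum_le_sum fun p _ => ?_
      apply ind_le_three
      · split_ifs <;> exact ind_nonneg _ _
      · intro hx
        rw [hD p x hx, hnv]
        have hv : v.1 x = x (σ 0) := rfl
        rw [hv]
        cases x (σ 0) <;> simp
    rw [hcard]
    calc _ ≤ (N * N)⁻¹ * ((∑ p, ∑ j, if x ∈ (D p j).1 then 1 else 0) + N * S) :=
          mul_le_mul_of_nonneg_left key (by positivity)
      _ = _ := by field_simp

lemma ess_dep {n : ℕ} (f : BF n) (s : Finset (Fin n)) :
    ∀ x y : Fin n → Bool, (∀ i, i ∉ s → x i = y i) → (∀ i, Essential f i → x i = y i) →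
      f x = f y := by
  induction s using Finset.induction_on with
  | empty => intro x y h _; congr 1; funext i; exact h i (by simp)
  | insert a s ha ih =>
    intro x y h1 h2
    have h3 : f (Function.update x a (y a)) = f x := by
      by_cases hxy : x a = y a
      · rw [← hxy, Function.update_eq_self]
      · have hne : ¬ Essential f a := fun h => hxy (h2 a h)
        simp only [Essential, not_exists, not_not] at hne
        have : y a = !(x a) := by cases hx : x a <;> cases hy : y a <;> simp_all
        rw [this]; exact hne x
    rw [← h3]
    apply ih
    · intro i hi
      by_cases hia : i = a
      · subst hia; simp
      · rw [Function.update_of_ne hia]; exact h1 i (by simp [hia, hi])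
    · intro i hi
      by_cases hia : i = a
      · subst hia; simp
      · rw [Function.update_of_ne hia]; exact h2 i hi

lemma ess_factor {n : ℕ} (f : BF n) :
    ∃ (σ : Fin (essCount f) → Fin n) (F : BF (essCount f)), ∀ x, f x = F (fun i => x (σ i)) := by
  have hc : Fintype.card {i | Essential f i} = essCount f := by
    rw [essCount, ← Nat.card_coe_set_eq, Nat.card_eq_fintype_card]
  let e : {i | Essential f i} ≃ Fin (essCount f) := Fintype.equivFinOfCardEq hc
  refine ⟨fun i => (e.symm i).1, fun y => f (fun i => if h : Essential f i then y (e ⟨i, h⟩)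
    else false), fun x => ?_⟩
  apply ess_dep f Finset.univ
  · simp
  · intro i hi
    simp [hi]

theorem stmt4 {n : ℕ} (Mdl : LegitModel n S3) (hneg : Mdl.NegExact) (f : BF n) :
    ∃ (a b : ℕ) (w : Fin a → ℝ) (δs : Fin a → Set (Fin n → Bool))
      (u : Fin b → ℝ) (hs : Fin b → BF n),
      (∀ i, 0 ≤ w i) ∧ (∑ i, w i) = 1 ∧ (∀ i, δs i ∈ Mdl.Delta) ∧
      (∀ i, 0 ≤ u i) ∧ (∑ i, u i) = 1 ∧ (∀ i, hs i ∈ Mdl.M) ∧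
      ∀ x, (∑ i, if hs i x ≠ f x then u i else 0) ≤
        (12 * (essCount f + 1) : ℝ) * (∑ i, if x ∈ δs i then w i else 0) := by
  obtain ⟨σ, F, hF⟩ := ess_factor f
  generalize essCount f = k at σ F hF ⊢
  obtain ⟨A, hA⟩ := main_rand Mdl hneg k σ
  choose ng hng using op_not Mdl hneg
  let T : BF k → BF k := fun g y => xor (F y) (g y)
  have hT : Function.Involutive T := fun g => by funext y; simp [T]
  choose r D hD using fun g : BF k => op_mux Mdl (A g) (ng (A (T g))) (ng (A g)) (A (T g))
  obtain ⟨w, hw0, hw1, hw⟩ := ((GoodW.three D).add hA).add hA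
  set N : ℝ := (Fintype.card (BF k) : ℝ) with hN
  have hN0 : 0 < N := by rw [hN]; exact_mod_cast Fintype.card_pos
  have hc : (0 : ℝ) < 3 + 3 * k + 3 * k := by positivity
  let e1 := (Fintype.equivFin Mdl.Delta).symm
  let e2 := (Fintype.equivFin (BF k)).symm
  refine ⟨_, _, fun i => (3 + 3 * k + 3 * k : ℝ)⁻¹ * w (e1 i), fun i => (e1 i).1,
    fun _ => N⁻¹, fun i => (r (e2 i)).1, fun i => mul_nonneg (by positivity) (hw0 _), ?_,
    fun i => (e1 i).2, fun _ => by positivity, ?_, fun i => (r (e2 i)).2, fun x => ?_⟩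
  · rw [← Finset.mul_sum, Equiv.sum_comp e1 w, hw1, inv_mul_cancel₀ hc.ne']
  · simp only [Finset.sum_const, Finset.card_univ, Fintype.card_fin, nsmul_eq_mul]
    exact mul_inv_cancel₀ hN0.ne'
  · rw [Equiv.sum_comp e2 (fun g => if (r g).1 x ≠ f x then N⁻¹ else 0),
      Equiv.sum_comp e1 (fun d => if x ∈ d.1 then (3 + 3 * k + 3 * k : ℝ)⁻¹ * w d else 0)]
    have h1 : ∑ g, ind ((r g).1 x) (f x) ≤ (∑ g, ∑ j, if x ∈ (D g j).1 then 1 else 0) +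
        (∑ g, ind ((A g).1 x) (g (fun i => x (σ i))) +
          ∑ g, ind ((A g).1 x) (g (fun i => x (σ i)))) := by
      conv_rhs => rw [← Equiv.sum_comp hT.toPerm (fun g => ind ((A g).1 x) (g (fun i => x (σ i))))]
      conv_rhs => rw [Equiv.sum_comp hT.toPerm (fun g => ind ((A g).1 x) (g (fun i => x (σ i))))]
      nth_rewrite 2 [← Equiv.sum_comp hT.toPerm (fun g => ind ((A g).1 x) (g (fun i => x (σ i))))]
      rw [← Finset.sum_add_distrib, ← Finset.sum_add_distrib]
      refine Finset.sum_le_sum fun g _ => ?_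
      apply ind_le_three
      · exact add_nonneg (ind_nonneg _ _) (ind_nonneg _ _)
      · intro hx
        rw [hD g x hx, hng, hng, hF]
        simp only [Function.Involutive.coe_toPerm]
        have hTg : T g (fun i => x (σ i)) = xor (F (fun i => x (σ i))) (g (fun i => x (σ i))) := rfl
        rw [hTg]
        generalize F (fun i => x (σ i)) = p
        generalize g (fun i => x (σ i)) = q
        generalize (A g).1 x = s
        generalize (A (T g)).1 x = t
        cases p <;> cases q <;> cases s <;> cases t <;> simp [ind]
    have h2 : ∑ g, (if (r g).1 x ≠ f x then N⁻¹ else 0) = N⁻¹ * ∑ g, ind ((r g).1 x) (f x) := by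
      rw [Finset.mul_sum]
      refine Finset.sum_congr rfl fun g _ => ?_
      unfold ind; split_ifs <;> simp
    have h3 : ∑ d : Mdl.Delta, (if x ∈ d.1 then (3 + 3 * k + 3 * k : ℝ)⁻¹ * w d else 0) =
        (3 + 3 * k + 3 * k : ℝ)⁻¹ * ∑ d : Mdl.Delta, if x ∈ d.1 then w d else 0 := by
      rw [Finset.mul_sum]
      refine Finset.sum_congr rfl fun g _ => ?_
      split_ifs <;> simp
    rw [h2, h3]
    have hW : 0 ≤ ∑ d : Mdl.Delta, if x ∈ d.1 then w d else 0 :=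
      Finset.sum_nonneg fun d _ => by split_ifs; exacts [hw0 d, le_rfl]
    have h4 := hw x
    set W := ∑ d : Mdl.Delta, if x ∈ d.1 then w d else 0
    have h5 := mul_le_mul_of_nonneg_left h1 (inv_nonneg.2 hN0.le)
    rw [mul_add, mul_add] at h5
    have h6 : W ≤ 12 * ((k : ℝ) + 1) * ((3 + 3 * k + 3 * k : ℝ)⁻¹ * W) := by
      have h7 : 1 ≤ 12 * ((k : ℝ) + 1) * (3 + 3 * k + 3 * k : ℝ)⁻¹ := by
        rw [← div_eq_mul_inv, le_div_iff₀ hc]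
        have : (0 : ℝ) ≤ k := Nat.cast_nonneg k
        linarith
      rw [← mul_assoc]
      exact le_mul_of_one_le_left hW h7
    linarith

end
end

section
/- There is an absolute constant K such that for every n, every 0-projective legitimate model ℳ of order n of the class of Boolean circuits over {¬, ∧₂, ∨₂} with ¬̄ := ¬, and every f ∈ ℱ_n with n₀ essential variables, ρ(f, ℳ) ≤ K · n₀². -/
open scoped Classical ENNReal

noncomputable section

namespace Aux

variable {n : ℕ} {S : Set Conn}

structure Node (n : ℕ) (S : Set Conn) (i : ℕ) where
  c : Conn
  hc : c ∈ S
  w : Fin c.1 → (Fin n ⊕ (Bool ⊕ Fin i))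

def portVal (Mdl : LegitModel n S) (r : ℕ → Mdl.M) {i : ℕ} :
    (Fin n ⊕ (Bool ⊕ Fin i)) → Mdl.M
  | Sum.inl v => ⟨fun x => x v, Mdl.var_mem v⟩
  | Sum.inr (Sum.inl b) => ⟨fun _ => b, Mdl.const_mem b⟩
  | Sum.inr (Sum.inr j) => r j.val

def nodeVal (Mdl : LegitModel n S) (r : ℕ → Mdl.M) {i : ℕ} (N : Node n S i) : Mdl.M :=
  Mdl.approx N.c N.hc (fun k => portVal Mdl r (N.w k))

def nodeUses (J : Set (Fin n)) {i : ℕ} (N : Node n S i) : Prop :=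
  ∀ k v, N.w k = Sum.inl v → v ∈ J

def mk (s : ℕ) (nd : (i : Fin s) → Node n S i.val) (o : Fin n ⊕ (Bool ⊕ Fin s)) :
    Circuit n S where
  size := s
  conn := fun i => (nd i).c
  conn_mem := fun i => (nd i).hc
  wires := fun i => (nd i).w
  output := o

def node (C : Circuit n S) (i : Fin C.size) : Node n S i.val :=
  ⟨C.conn i, C.conn_mem i, C.wires i⟩

def gA (Mdl : LegitModel n S) (C : Circuit n S) : ℕ → Mdl.M :=
  Circuit.gateApproxWith Mdl C (fun i => ⟨fun x => x i, Mdl.var_mem i⟩)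

theorem gA_eq (Mdl : LegitModel n S) (C : Circuit n S) (i : ℕ) (h : i < C.size) :
    gA Mdl C i = nodeVal Mdl (gA Mdl C) (node C ⟨i, h⟩) := by
  unfold gA
  rw [Circuit.gateApproxWith, dif_pos h]
  unfold nodeVal node
  congr 1
  funext k
  simp only
  rcases C.wires ⟨i, h⟩ k with v | b | j <;> rfl

theorem approxEval_eq (Mdl : LegitModel n S) (C : Circuit n S) :
    Circuit.approxEval Mdl C = portVal Mdl (gA Mdl C) C.output := by
  unfold Circuit.approxEval Circuit.approxEvalWith gA
  rcases C.output with v | b | j <;> rfl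

def mapPort {i j : ℕ} (g : Fin i → Fin j) :
    (Fin n ⊕ (Bool ⊕ Fin i)) → (Fin n ⊕ (Bool ⊕ Fin j))
  | Sum.inl v => Sum.inl v
  | Sum.inr (Sum.inl b) => Sum.inr (Sum.inl b)
  | Sum.inr (Sum.inr k) => Sum.inr (Sum.inr (g k))

def mapNode {i j : ℕ} (g : Fin i → Fin j) (N : Node n S i) : Node n S j :=
  ⟨N.c, N.hc, fun k => mapPort g (N.w k)⟩

theorem portVal_map (Mdl : LegitModel n S) (r r' : ℕ → Mdl.M) {i j : ℕ} (g : Fin i → Fin j)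
    (h : ∀ k, r' (g k).val = r k.val) (p : Fin n ⊕ (Bool ⊕ Fin i)) :
    portVal Mdl r' (mapPort g p) = portVal Mdl r p := by
  rcases p with v | b | k
  · rfl
  · rfl
  · exact h k

theorem nodeVal_map (Mdl : LegitModel n S) (r r' : ℕ → Mdl.M) {i j : ℕ} (g : Fin i → Fin j)
    (h : ∀ k, r' (g k).val = r k.val) (N : Node n S i) :
    nodeVal Mdl r' (mapNode g N) = nodeVal Mdl r N := by
  unfold nodeVal mapNode
  congr 1
  funext k
  exact portVal_map Mdl r r' g h _

theorem mapPort_inl {i j : ℕ} (g : Fin i → Fin j) (p : Fin n ⊕ (Bool ⊕ Fin i)) (v : Fin n)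
    (h : mapPort g p = Sum.inl v) : p = Sum.inl v := by
  rcases p with v' | b | k
  · simpa [mapPort] using h
  · simp [mapPort] at h
  · simp [mapPort] at h

theorem nodeUses_map {J : Set (Fin n)} {i j : ℕ} (g : Fin i → Fin j) (N : Node n S i)
    (h : nodeUses J N) : nodeUses J (mapNode g N) := by
  intro k v hk
  exact h k v (mapPort_inl g _ v hk)

def mergeNd (C D : Circuit n S) (i : Fin (C.size + D.size)) : Node n S i.val :=
  if h : i.val < C.size then node C ⟨i.val, h⟩
  else mapNode (fun j : Fin (i.val - C.size) => (⟨j.val + C.size, by omega⟩ : Fin i.val))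
    (node D ⟨i.val - C.size, by omega⟩)

theorem merge_left (Mdl : LegitModel n S) (C D : Circuit n S) (o) (i : ℕ) (hi : i < C.size) :
    gA Mdl (mk _ (mergeNd C D) o) i = gA Mdl C i := by
  induction i using Nat.strong_induction_on with
  | _ i ih =>
    rw [gA_eq Mdl C i hi, gA_eq Mdl (mk _ (mergeNd C D) o) i (by simp only [mk]; omega)]
    change nodeVal Mdl _ (mergeNd C D _) = _
    unfold mergeNd
    rw [dif_pos hi]
    have := nodeVal_map Mdl (gA Mdl C) (gA Mdl (mk _ (mergeNd C D) o)) (fun j : Fin i => j)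
      (fun k => ih k.val k.isLt (by omega)) (node C ⟨i, hi⟩)
    rw [← this]
    unfold nodeVal mapNode
    congr 1
    funext k
    simp only
    rcases (node C ⟨i, hi⟩).w k with v | b | j <;> rfl

theorem merge_right (Mdl : LegitModel n S) (C D : Circuit n S) (o) (i : ℕ) (hi : i < D.size) :
    gA Mdl (mk _ (mergeNd C D) o) (i + C.size) = gA Mdl D i := by
  induction i using Nat.strong_induction_on with
  | _ i ih =>
    have key : ∀ a (ha : a < C.size + D.size), a - C.size = i → ¬ a < C.size →
        nodeVal Mdl (gA Mdl (mk _ (mergeNd C D) o)) (mergeNd C D ⟨a, ha⟩) = gA Mdl D i := by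
      rintro a ha rfl hna
      rw [gA_eq Mdl D _ hi]
      unfold mergeNd
      rw [dif_neg hna]
      apply nodeVal_map
      intro k
      exact ih k.val k.isLt (by have := k.isLt; omega)
    rw [gA_eq Mdl (mk _ (mergeNd C D) o) (i + C.size) (by simp only [mk]; omega)]
    exact key _ (by omega) (by omega) (by omega)

def Uses (C : Circuit n S) (J : Set (Fin n)) : Prop := ∀ i, nodeUses J (node C i)

def addNd (C : Circuit n S) (N : Node n S C.size) (i : Fin (C.size + 1)) : Node n S i.val :=
  if h : i.val < C.size then node C ⟨i.val, h⟩
  else mapNode (fun j : Fin C.size => (⟨j.val, by omega⟩ : Fin i.val)) N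

theorem add_left (Mdl : LegitModel n S) (C : Circuit n S) (N) (o) (i : ℕ) (hi : i < C.size) :
    gA Mdl (mk _ (addNd C N) o) i = gA Mdl C i := by
  induction i using Nat.strong_induction_on with
  | _ i ih =>
    rw [gA_eq Mdl C i hi, gA_eq Mdl (mk _ (addNd C N) o) i (by simp only [mk]; omega)]
    change nodeVal Mdl _ (addNd C N _) = _
    unfold addNd
    rw [dif_pos hi]
    have := nodeVal_map Mdl (gA Mdl C) (gA Mdl (mk _ (addNd C N) o)) (fun j : Fin i => j)
      (fun k => ih k.val k.isLt (by omega)) (node C ⟨i, hi⟩)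
    rw [← this]
    unfold nodeVal mapNode
    congr 1
    funext k
    simp only
    rcases (node C ⟨i, hi⟩).w k with v | b | j <;> rfl

/-- `g` is the approximator of a circuit over variables in `J`. -/
def P (Mdl : LegitModel n S) (J : Set (Fin n)) (g : Mdl.M) : Prop :=
  ∃ C : Circuit n S, C.UsesVars J ∧ Circuit.approxEval Mdl C = g

theorem P_add (Mdl : LegitModel n S) (J : Set (Fin n)) (C : Circuit n S) (hC : Uses C J)
    (N : Node n S C.size) (hN : nodeUses J N) : P Mdl J (nodeVal Mdl (gA Mdl C) N) := by
  refine ⟨mk _ (addNd C N) (Sum.inr (Sum.inr ⟨C.size, by omega⟩)), ⟨?_, ?_⟩, ?_⟩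
  · intro i k v h
    have : nodeUses J (addNd C N i) := by
      unfold addNd
      split_ifs
      · exact hC _
      · exact nodeUses_map _ _ hN
    exact this k v h
  · intro v h
    cases h
  · rw [approxEval_eq]
    change gA Mdl (mk _ (addNd C N) _) C.size = _
    rw [gA_eq _ _ _ (by simp only [mk]; omega)]
    change nodeVal Mdl _ (addNd C N _) = _
    have : addNd C N ⟨C.size, by omega⟩ =
      mapNode (fun j : Fin C.size => (⟨j.val, by omega⟩ : Fin C.size)) N := by
      unfold addNd
      rw [dif_neg (by simp)]
    refine (congrArg (nodeVal Mdl _) this).trans ?_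
    apply nodeVal_map
    intro k
    exact add_left Mdl C N _ _ k.isLt

theorem uses_of (C : Circuit n S) (J : Set (Fin n)) (h : C.UsesVars J) : Uses C J :=
  fun i k v hk => h.1 i k v hk

theorem P_unary (Mdl : LegitModel n S) (J : Set (Fin n)) (F : (Fin 1 → Bool) → Bool)
    (hc : (⟨1, F⟩ : Conn) ∈ S) (a : Mdl.M) (ha : P Mdl J a) :
    P Mdl J (Mdl.approx ⟨1, F⟩ hc (fun _ => a)) := by
  obtain ⟨C, hC, rfl⟩ := ha
  have := P_add Mdl J C (uses_of _ _ hC) ⟨⟨1, F⟩, hc, fun _ => C.output⟩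
    (fun k v h => hC.2 v h)
  rw [approxEval_eq]
  exact this

theorem P_binary (Mdl : LegitModel n S) (J : Set (Fin n)) (F : (Fin 2 → Bool) → Bool)
    (hc : (⟨2, F⟩ : Conn) ∈ S) (a b : Mdl.M) (ha : P Mdl J a) (hb : P Mdl J b) :
    P Mdl J (Mdl.approx ⟨2, F⟩ hc ![a, b]) := by
  obtain ⟨C, hC, rfl⟩ := ha
  obtain ⟨D, hD, rfl⟩ := hb
  let E := mk _ (mergeNd C D) (Sum.inr (Sum.inl true))
  let p1 : Fin n ⊕ (Bool ⊕ Fin E.size) := mapPort (fun j : Fin C.size => (⟨j.val, by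
      change j.val < C.size + D.size; omega⟩ : Fin E.size)) C.output
  let p2 : Fin n ⊕ (Bool ⊕ Fin E.size) := mapPort (fun j : Fin D.size => (⟨j.val + C.size, by
      change j.val + C.size < C.size + D.size; omega⟩ : Fin E.size)) D.output
  have hE : Uses E J := by
    intro i
    change nodeUses J (mergeNd C D i)
    unfold mergeNd
    split_ifs
    · exact uses_of _ _ hC _
    · exact nodeUses_map _ _ (uses_of _ _ hD _)
  have := P_add Mdl J E hE ⟨⟨2, F⟩, hc, ![p1, p2]⟩ (by
    intro k v h
    change ![p1, p2] k = _ at h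
    have hk : k = (0 : Fin 2) ∨ k = (1 : Fin 2) := by
      have h2 : ∀ k : Fin 2, k = 0 ∨ k = 1 := by decide
      exact h2 k
    rcases hk with rfl | rfl
    · exact hC.2 v (mapPort_inl _ _ _ h)
    · exact hD.2 v (mapPort_inl _ _ _ h))
  have e : (![Circuit.approxEval Mdl C, Circuit.approxEval Mdl D] : Fin 2 → Mdl.M)
      = fun k => portVal Mdl (gA Mdl E) (![p1, p2] k) := by
    funext k
    have h2 : ∀ k : Fin 2, k = 0 ∨ k = 1 := by decide
    rcases h2 k with rfl | rfl
    · change Circuit.approxEval Mdl C = portVal Mdl (gA Mdl E) p1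
      rw [approxEval_eq]
      exact (portVal_map Mdl (gA Mdl C) (gA Mdl E) (fun j : Fin C.size => (⟨j.val, by
        change j.val < C.size + D.size; omega⟩ : Fin E.size))
        (fun k => merge_left Mdl C D _ _ k.isLt) C.output).symm
    · change Circuit.approxEval Mdl D = portVal Mdl (gA Mdl E) p2
      rw [approxEval_eq]
      exact (portVal_map Mdl (gA Mdl D) (gA Mdl E) (fun j : Fin D.size => (⟨j.val + C.size, by
        change j.val + C.size < C.size + D.size; omega⟩ : Fin E.size))
        (fun k => merge_right Mdl C D _ _ k.isLt) D.output).symm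
  rw [e]
  exact this

theorem P_const (Mdl : LegitModel n S) (J : Set (Fin n)) (b : Bool) :
    P Mdl J ⟨fun _ => b, Mdl.const_mem b⟩ :=
  ⟨mk 0 (fun i => i.elim0) (Sum.inr (Sum.inl b)),
    ⟨fun i => i.elim0, fun v h => by cases h⟩, by rw [approxEval_eq]; rfl⟩

theorem P_var (Mdl : LegitModel n S) (J : Set (Fin n)) (i : Fin n) (hi : i ∈ J) :
    P Mdl J ⟨fun x => x i, Mdl.var_mem i⟩ :=
  ⟨mk 0 (fun i => i.elim0) (Sum.inl i),
    ⟨fun i => i.elim0, fun v h => by cases h; exact hi⟩, by rw [approxEval_eq]; rfl⟩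

end Aux

end

noncomputable section

namespace Aux

open Finset

/-- greedy covering -/
theorem greedy_cover {α I : Type*} [Fintype I] [Nonempty I] (X : Finset α) (A : I → Set α)
    (q : ℕ) (h : ∀ x ∈ X, Fintype.card I ≤ q * #{i : I | x ∈ A i}) (t : ℕ) :
    ∃ l : List I, l.length = t ∧ #{x ∈ X | ∀ i ∈ l, x ∉ A i} * q ^ t ≤ (q - 1) ^ t * #X := by
  induction t with
  | zero => exact ⟨[], rfl, by simp⟩
  | succ t ih =>
    obtain ⟨l, hl, hc⟩ := ih
    set Y : Finset α := {x ∈ X | ∀ i ∈ l, x ∉ A i} with hY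
    have hs : ∑ i : I, #Y ≤ ∑ i : I, q * #{x ∈ Y | x ∈ A i} := by
      rw [← Finset.mul_sum]
      have : ∑ i : I, #{x ∈ Y | x ∈ A i} = ∑ x ∈ Y, #{i : I | x ∈ A i} := by
        simp only [Finset.card_filter]
        rw [Finset.sum_comm]
      rw [this, Finset.mul_sum, Finset.sum_const, smul_eq_mul, Finset.card_univ, mul_comm]
      calc #Y * Fintype.card I = ∑ x ∈ Y, Fintype.card I := by simp
        _ ≤ _ := Finset.sum_le_sum (fun x hx => h x (Finset.mem_filter.1 hx).1)
    obtain ⟨i, -, hi⟩ := Finset.exists_le_of_sum_le Finset.univ_nonempty hs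
    refine ⟨i :: l, by simp [hl], ?_⟩
    have h1 : #{x ∈ X | ∀ j ∈ i :: l, x ∉ A j} + #{x ∈ Y | x ∈ A i} = #Y := by
      rw [← Finset.card_filter_add_card_filter_not (s := Y) (fun x => x ∈ A i), add_comm]
      congr 2
      ext x
      simp [hY]
      tauto
    set u := #{x ∈ X | ∀ j ∈ i :: l, x ∉ A j}
    set v := #{x ∈ Y | x ∈ A i}
    have h2 : u * q ≤ (q - 1) * #Y := by
      rcases q with _ | q
      · simp
      · simp only [Nat.add_sub_cancel]
        nlinarith
    calc u * q ^ (t+1) = (u * q) * q ^ t := by ring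
      _ ≤ ((q - 1) * #Y) * q ^ t := Nat.mul_le_mul_right _ h2
      _ = (q - 1) * (#Y * q ^ t) := by ring
      _ ≤ (q - 1) * ((q - 1) ^ t * #X) := Nat.mul_le_mul_left _ hc
      _ = _ := by ring

theorem pow_half (q : ℕ) (hq : 1 ≤ q) : 2 * (q - 1) ^ q ≤ q ^ q := by
  obtain ⟨p, rfl⟩ : ∃ p, q = p + 1 := ⟨q - 1, by omega⟩
  simp only [Nat.add_sub_cancel]
  rw [add_pow, Finset.sum_range_succ, Finset.sum_range_succ]
  simp only [one_pow, mul_one, Nat.choose_self, Nat.cast_one, Nat.sub_self]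
  have : (p + 1).choose p = p + 1 := by simp
  rw [this]
  simp only [pow_succ, Nat.cast_id]
  nlinarith [Nat.zero_le (∑ x ∈ range p, p ^ x * (p + 1).choose x), Nat.zero_le (p ^ p)]

theorem greedy_cover' {α I : Type*} [Fintype I] [Nonempty I] (X : Finset α) (A : I → Set α)
    (q m : ℕ) (hq : 1 ≤ q) (hX : #X ≤ 2 ^ m)
    (h : ∀ x ∈ X, Fintype.card I ≤ q * #{i : I | x ∈ A i}) :
    ∃ l : List I, l.length = q * (m + 1) ∧ ∀ x ∈ X, ∃ i ∈ l, x ∈ A i := by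
  obtain ⟨l, hl, hc⟩ := greedy_cover X A q h (q * (m + 1))
  refine ⟨l, hl, ?_⟩
  by_contra! hcon
  obtain ⟨x, hx, hx'⟩ := hcon
  have h1 : 1 ≤ #{x ∈ X | ∀ i ∈ l, x ∉ A i} :=
    Finset.card_pos.2 ⟨x, by simp [hx]; exact hx'⟩
  have h2 := Nat.pow_le_pow_left (pow_half q hq) (m + 1)
  rw [mul_pow, ← pow_mul, ← pow_mul] at h2
  have h3 : 0 < q ^ (q * (m + 1)) := by positivity
  set Q := q ^ (q * (m + 1))
  set R := (q - 1) ^ (q * (m + 1))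
  have h4 : Q ≤ R * 2 ^ m :=
    calc Q = 1 * Q := by ring
      _ ≤ _ := Nat.mul_le_mul_right _ h1
      _ ≤ _ := hc
      _ ≤ _ := Nat.mul_le_mul_left _ hX
  rw [pow_succ] at h2
  have h5 : 0 < R * 2 ^ m := by omega
  nlinarith

/-- greedy majority -/
theorem greedy_maj {α Ω : Type*} [Fintype Ω] [Nonempty Ω] (X : Finset α) (W : Ω → α → Prop)
    (h : ∀ x ∈ X, 15 * #{w : Ω | W w x} ≤ Fintype.card Ω) (t : ℕ) :
    ∃ l : List Ω, l.length = t ∧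
      ∑ x ∈ X, 16 ^ (l.countP (fun w => decide (W w x))) ≤ 2 ^ t * #X := by
  induction t with
  | zero => exact ⟨[], rfl, by simp⟩
  | succ t ih =>
    obtain ⟨l, hl, hc⟩ := ih
    set c : α → ℕ := fun x => 16 ^ (l.countP (fun w => decide (W w x))) with hcdef
    have hs : ∑ w : Ω, ∑ x ∈ X, c x * (1 + if W w x then 15 else 0)
        ≤ ∑ w : Ω, 2 * ∑ x ∈ X, c x := by
      rw [Finset.sum_comm]
      simp only [← Finset.mul_sum, Finset.sum_add_distrib, Finset.sum_const, smul_eq_mul, mul_one,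
        Finset.card_univ]
      have : 2 * (Fintype.card Ω * ∑ x ∈ X, c x) = ∑ x ∈ X, c x * (2 * Fintype.card Ω) := by
        rw [← Finset.sum_mul]; ring
      rw [this]
      apply Finset.sum_le_sum
      intro x hx
      apply Nat.mul_le_mul_left
      have := h x hx
      rw [Finset.card_filter, Finset.mul_sum] at this
      simp only [mul_ite, mul_one, mul_zero] at this
      omega
    obtain ⟨w, -, hw⟩ := Finset.exists_le_of_sum_le Finset.univ_nonempty hs
    refine ⟨w :: l, by simp [hl], ?_⟩
    calc ∑ x ∈ X, 16 ^ ((w :: l).countP (fun w => decide (W w x)))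
        = ∑ x ∈ X, c x * (1 + if W w x then 15 else 0) := by
          apply Finset.sum_congr rfl
          intro x _
          rw [List.countP_cons, hcdef]
          by_cases hW : W w x <;> simp [hW, pow_succ]
      _ ≤ 2 * ∑ x ∈ X, c x := hw
      _ ≤ 2 * (2 ^ t * #X) := Nat.mul_le_mul_left _ hc
      _ = _ := by ring

theorem greedy_maj' {α Ω : Type*} [Fintype Ω] [Nonempty Ω] (X : Finset α) (W : Ω → α → Prop)
    (m : ℕ) (hX : #X ≤ 2 ^ m)
    (h : ∀ x ∈ X, 15 * #{w : Ω | W w x} ≤ Fintype.card Ω) :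
    ∃ l : List Ω, l.length = 2 * m + 1 ∧
      ∀ x ∈ X, l.countP (fun w => decide (W w x)) ≤ m := by
  obtain ⟨l, hl, hc⟩ := greedy_maj X W h (2 * m + 1)
  refine ⟨l, hl, fun x hx => ?_⟩
  by_contra! hcon
  have h1 := Finset.single_le_sum (f := fun x => 16 ^ (l.countP (fun w => decide (W w x))))
    (fun _ _ => Nat.zero_le _) hx
  have h2 : 16 ^ (m + 1) ≤ 16 ^ (l.countP (fun w => decide (W w x))) :=
    Nat.pow_le_pow_right (by norm_num) hcon
  have h3 : 2 ^ (2 * m + 1) * #X ≤ 2 ^ (2 * m + 1) * 2 ^ m := Nat.mul_le_mul_left _ hX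
  rw [← pow_add] at h3
  have h4 : 2 ^ (2 * m + 1 + m) < 2 ^ (4 * (m + 1)) := Nat.pow_lt_pow_right (by norm_num) (by omega)
  rw [pow_mul] at h4
  norm_num at h4
  omega

end Aux

end

noncomputable section

namespace Aux

open Finset

variable {n : ℕ}

theorem not_mem3 : notConn ∈ S3 := Or.inl rfl
theorem and_mem3 : andConn ∈ S3 := Or.inr (Or.inl rfl)
theorem or_mem3 : orConn ∈ S3 := Or.inr (Or.inr rfl)

def notA (Mdl : LegitModel n S3) (a : Mdl.M) : Mdl.M := Mdl.approx notConn not_mem3 (fun _ => a)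
def andA (Mdl : LegitModel n S3) (a b : Mdl.M) : Mdl.M := Mdl.approx andConn and_mem3 ![a, b]
def orA (Mdl : LegitModel n S3) (a b : Mdl.M) : Mdl.M := Mdl.approx orConn or_mem3 ![a, b]
def dAnd (Mdl : LegitModel n S3) (a b : Mdl.M) : Set (Fin n → Bool) :=
  Mdl.errSet andConn and_mem3 ![a, b]
def dOr (Mdl : LegitModel n S3) (a b : Mdl.M) : Set (Fin n → Bool) :=
  Mdl.errSet orConn or_mem3 ![a, b]

def ErrJ (Mdl : LegitModel n S3) (J : Set (Fin n)) : Set (Set (Fin n → Bool)) :=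
  {δ | δ ∈ Mdl.Delta ∧ ∀ z y : Fin n → Bool, (∀ j ∈ J, z j = y j) → (z ∈ δ ↔ y ∈ δ)}

theorem P_inv (Mdl : LegitModel n S3) (hz : Mdl.ZeroProjective) (J : Set (Fin n)) (a : Mdl.M)
    (ha : P Mdl J a) (z y : Fin n → Bool) (h : ∀ j ∈ J, z j = y j) : a.1 z = a.1 y := by
  obtain ⟨C, hC, rfl⟩ := ha
  exact hz C J hC z y h

theorem mem_dAnd (Mdl : LegitModel n S3) (a b : Mdl.M) (x) :
    x ∈ dAnd Mdl a b ↔ (a.1 x && b.1 x) ≠ (andA Mdl a b).1 x := Iff.rfl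
theorem mem_dOr (Mdl : LegitModel n S3) (a b : Mdl.M) (x) :
    x ∈ dOr Mdl a b ↔ (a.1 x || b.1 x) ≠ (orA Mdl a b).1 x := Iff.rfl

theorem P_not (Mdl : LegitModel n S3) (J : Set (Fin n)) (a : Mdl.M)
    (ha : P Mdl J a) : P Mdl J (notA Mdl a) := P_unary Mdl J _ _ a ha
theorem P_and (Mdl : LegitModel n S3) (J : Set (Fin n)) (a b : Mdl.M)
    (ha : P Mdl J a) (hb : P Mdl J b) : P Mdl J (andA Mdl a b) := P_binary Mdl J _ _ a b ha hb
theorem P_or (Mdl : LegitModel n S3) (J : Set (Fin n)) (a b : Mdl.M)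
    (ha : P Mdl J a) (hb : P Mdl J b) : P Mdl J (orA Mdl a b) := P_binary Mdl J _ _ a b ha hb

theorem dAnd_mem (Mdl : LegitModel n S3) (hz : Mdl.ZeroProjective) (J : Set (Fin n)) (a b : Mdl.M)
    (ha : P Mdl J a) (hb : P Mdl J b) : dAnd Mdl a b ∈ ErrJ Mdl J := by
  refine ⟨⟨_, _, _, rfl⟩, fun z y h => ?_⟩
  rw [mem_dAnd, mem_dAnd, P_inv Mdl hz J a ha z y h, P_inv Mdl hz J b hb z y h,
    P_inv Mdl hz J _ (P_and Mdl J a b ha hb) z y h]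

theorem dOr_mem (Mdl : LegitModel n S3) (hz : Mdl.ZeroProjective) (J : Set (Fin n)) (a b : Mdl.M)
    (ha : P Mdl J a) (hb : P Mdl J b) : dOr Mdl a b ∈ ErrJ Mdl J := by
  refine ⟨⟨_, _, _, rfl⟩, fun z y h => ?_⟩
  rw [mem_dOr, mem_dOr, P_inv Mdl hz J a ha z y h, P_inv Mdl hz J b hb z y h,
    P_inv Mdl hz J _ (P_or Mdl J a b ha hb) z y h]

theorem notA_val (Mdl : LegitModel n S3) (hn : Mdl.NegExact) (a : Mdl.M) (x) :
    (notA Mdl a).1 x = !(a.1 x) := congrFun (hn not_mem3 (fun _ => a)) x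

/-- `(a ∧ b) ∨ (c ∧ d)` -/
def mux (Mdl : LegitModel n S3) (a b c d : Mdl.M) : Mdl.M :=
  orA Mdl (andA Mdl a b) (andA Mdl c d)

def muxErrs (Mdl : LegitModel n S3) (a b c d : Mdl.M) : List (Set (Fin n → Bool)) :=
  [dAnd Mdl a b, dAnd Mdl c d, dOr Mdl (andA Mdl a b) (andA Mdl c d)]

theorem mux_val (Mdl : LegitModel n S3) (a b c d : Mdl.M) (x)
    (h : ¬ ∃ δ ∈ muxErrs Mdl a b c d, x ∈ δ) :
    (mux Mdl a b c d).1 x = ((a.1 x && b.1 x) || (c.1 x && d.1 x)) := by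
  simp only [muxErrs, List.mem_cons, List.not_mem_nil, or_false, exists_eq_or_imp,
    exists_eq_left, not_or, mem_dAnd, mem_dOr, not_not] at h
  obtain ⟨h1, h2, h3⟩ := h
  rw [h1, h2, h3]
  rfl

theorem P_mux (Mdl : LegitModel n S3) (J : Set (Fin n)) (a b c d : Mdl.M)
    (ha : P Mdl J a) (hb : P Mdl J b) (hc : P Mdl J c) (hd : P Mdl J d) :
    P Mdl J (mux Mdl a b c d) :=
  P_or _ _ _ _ (P_and _ _ _ _ ha hb) (P_and _ _ _ _ hc hd)

theorem muxErrs_mem (Mdl : LegitModel n S3) (hz : Mdl.ZeroProjective) (J : Set (Fin n))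
    (a b c d : Mdl.M)
    (ha : P Mdl J a) (hb : P Mdl J b) (hc : P Mdl J c) (hd : P Mdl J d) :
    ∀ δ ∈ muxErrs Mdl a b c d, δ ∈ ErrJ Mdl J := by
  intro δ h
  simp only [muxErrs, List.mem_cons, List.not_mem_nil, or_false] at h
  rcases h with rfl | rfl | rfl
  · exact dAnd_mem _ hz _ _ _ ha hb
  · exact dAnd_mem _ hz _ _ _ hc hd
  · exact dOr_mem _ hz _ _ _ (P_and _ _ _ _ ha hb) (P_and _ _ _ _ hc hd)

def flp (i : Fin n) (x : Fin n → Bool) : Fin n → Bool := Function.update x i (!(x i))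

theorem flp_flp (i : Fin n) (x : Fin n → Bool) : flp i (flp i x) = x := by
  simp [flp]

def pt : List (Fin n) → (Fin n → Bool) → (Fin n → Bool)
  | [], _ => fun _ => false
  | i :: L, x => if x i then flp i (pt L x) else pt L x

theorem pt_val (L : List (Fin n)) (hL : L.Nodup) (x : Fin n → Bool) (j : Fin n) :
    pt L x j = if j ∈ L then x j else false := by
  induction L with
  | nil => simp [pt]
  | cons i L ih =>
    rw [List.nodup_cons] at hL
    have ih := ih hL.2
    simp only [pt, List.mem_cons]
    by_cases hj : j = i
    · subst hj
      rw [if_neg hL.1] at ih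
      cases hx : x j <;> simp [flp, ih]
    · cases hx : x i <;> simp [flp, hj, ih]

theorem pt_card (L : List (Fin n)) : #(univ.image (pt L)) ≤ 2 ^ L.length := by
  induction L with
  | nil =>
    have : univ.image (pt ([] : List (Fin n))) ⊆ {fun _ => false} := by
      intro y hy
      simp [pt] at hy ⊢
      exact hy.symm
    simpa using Finset.card_le_card this
  | cons i L ih =>
    have : univ.image (pt (i :: L)) ⊆ (univ.image (pt L)).image (flp i) ∪ univ.image (pt L) := by
      intro y hy
      obtain ⟨x, -, rfl⟩ := Finset.mem_image.1 hy
      simp only [pt]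
      split_ifs
      · exact Finset.mem_union_left _ (Finset.mem_image_of_mem _ (Finset.mem_image_of_mem _ (Finset.mem_univ _)))
      · exact Finset.mem_union_right _ (Finset.mem_image_of_mem _ (Finset.mem_univ _))
    have h1 := Finset.card_le_card this
    have h2 := Finset.card_union_le ((univ.image (pt L)).image (flp i)) (univ.image (pt L))
    have h3 : #((univ.image (pt L)).image (flp i)) ≤ #(univ.image (pt L)) := Finset.card_image_le
    rw [List.length_cons, pow_succ]
    omega

def vr (Mdl : LegitModel n S3) (i : Fin n) : Mdl.M := ⟨fun x => x i, Mdl.var_mem i⟩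
def cs (Mdl : LegitModel n S3) (b : Bool) : Mdl.M := ⟨fun _ => b, Mdl.const_mem b⟩

def F (Mdl : LegitModel n S3) : List (Fin n) → BF n → Mdl.M
  | [], h => cs Mdl (h (fun _ => false))
  | i :: L, h => mux Mdl (vr Mdl i) (F Mdl L (h ∘ flp i)) (notA Mdl (vr Mdl i)) (F Mdl L h)

def V (Mdl : LegitModel n S3) : List (Fin n) → ℕ → BF n → List (Set (Fin n → Bool))
  | [], _, _ => []
  | i :: L, 0, h =>
    muxErrs Mdl (vr Mdl i) (F Mdl L (h ∘ flp i)) (notA Mdl (vr Mdl i)) (F Mdl L h)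
  | _ :: L, k + 1, h => V Mdl L k h

theorem P_F (Mdl : LegitModel n S3) (J : Set (Fin n)) (L : List (Fin n)) (hL : ∀ i ∈ L, i ∈ J)
    (h : BF n) : P Mdl J (F Mdl L h) := by
  induction L generalizing h with
  | nil => exact P_const _ _ _
  | cons i L ih =>
    have ih := ih (fun j hj => hL j (List.mem_cons_of_mem _ hj))
    have hi := P_var Mdl J i (hL i List.mem_cons_self)
    exact P_mux _ _ _ _ _ _ hi (ih _) (P_not _ _ _ hi) (ih _)

theorem V_mem (Mdl : LegitModel n S3) (hz : Mdl.ZeroProjective) (J : Set (Fin n))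
    (L : List (Fin n)) (hL : ∀ i ∈ L, i ∈ J) (k : ℕ)
    (h : BF n) : (V Mdl L k h).length ≤ 3 ∧ ∀ δ ∈ V Mdl L k h, δ ∈ ErrJ Mdl J := by
  induction L generalizing k with
  | nil => simp [V]
  | cons i L ih =>
    have hL' : ∀ j ∈ L, j ∈ J := (fun j hj => hL j (List.mem_cons_of_mem _ hj))
    have hi := P_var Mdl J i (hL i List.mem_cons_self)
    cases k with
    | zero =>
      exact ⟨le_rfl, muxErrs_mem _ hz _ _ _ _ _ hi (P_F _ _ _ hL' _) (P_not _ _ _ hi)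
        (P_F _ _ _ hL' _)⟩
    | succ k => exact ih hL' k

theorem flp_card (i : Fin n) (Q : BF n → Prop) :
    #{h : BF n | Q (h ∘ flp i)} = #{h : BF n | Q h} := by
  have e : ∀ h : BF n, (h ∘ flp i) ∘ flp i = h := by
    intro h; funext x; simp [flp_flp]
  refine Finset.card_nbij' (fun h => h ∘ flp i) (fun h => h ∘ flp i) ?_ ?_ ?_ ?_
  · intro h hh
    simpa using hh
  · intro h hh
    simp only [Finset.coe_filter, Finset.mem_univ, true_and, Set.mem_setOf_eq] at hh ⊢
    rwa [e]
  · intro h _; exact e h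
  · intro h _; exact e h

theorem F_count (Mdl : LegitModel n S3) (hn : Mdl.NegExact) (x : Fin n → Bool)
    (L : List (Fin n)) :
    #{h : BF n | (F Mdl L h).1 x ≠ h (pt L x)} ≤
      ∑ k ∈ range L.length, #{h : BF n | ∃ δ ∈ V Mdl L k h, x ∈ δ} := by
  induction L with
  | nil => simp [F, pt, cs]
  | cons i L ih =>
    rw [List.length_cons, Finset.sum_range_succ']
    change _ ≤ (∑ k ∈ range L.length, #{h : BF n | ∃ δ ∈ V Mdl L k h, x ∈ δ}) + _
    refine le_trans ?_ (Nat.add_le_add_right ih _)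
    have key : ∀ h : BF n, (F Mdl (i :: L) h).1 x ≠ h (pt (i :: L) x) →
        ¬ (∃ δ ∈ V Mdl (i :: L) 0 h, x ∈ δ) →
        if x i = true then (F Mdl L (h ∘ flp i)).1 x ≠ (h ∘ flp i) (pt L x)
          else (F Mdl L h).1 x ≠ h (pt L x) := by
      intro h h1 h2
      have h3 := mux_val _ _ _ _ _ _ h2
      change (F Mdl (i :: L) h).1 x = _ at h3
      rw [h3, notA_val Mdl hn] at h1
      change ((x i && _) || (!(x i) && _)) ≠ _ at h1
      cases hx : x i
      · simpa [hx, pt] using h1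
      · simpa [hx, pt] using h1
    by_cases hx : x i = true
    · simp only [hx, if_true] at key
      have hfl : #{h : BF n | (F Mdl L h).1 x ≠ h (pt L x)} =
          #{h : BF n | (F Mdl L (h ∘ flp i)).1 x ≠ (h ∘ flp i) (pt L x)} := by
        convert (flp_card i (fun h => (F Mdl L h).1 x ≠ h (pt L x))).symm
      rw [hfl]
      refine le_trans (Finset.card_le_card ?_) (Finset.card_union_le _ _)
      intro h hh
      simp only [Finset.mem_filter, Finset.mem_univ, true_and, Finset.mem_union] at hh ⊢
      by_cases h2 : ∃ δ ∈ V Mdl (i :: L) 0 h, x ∈ δ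
      · exact Or.inr h2
      · exact Or.inl (key h hh h2)
    · simp only [hx] at key
      refine le_trans (Finset.card_le_card ?_) (Finset.card_union_le _ _)
      intro h hh
      simp only [Finset.mem_filter, Finset.mem_univ, true_and, Finset.mem_union] at hh ⊢
      by_cases h2 : ∃ δ ∈ V Mdl (i :: L) 0 h, x ∈ δ
      · exact Or.inr h2
      · exact Or.inl (by simpa using key h hh h2)

def xr (f g : BF n) : BF n := fun x => xor (f x) (g x)

theorem xr_xr (f g : BF n) : xr f (xr f g) = g := by
  funext x; simp [xr]

def G (Mdl : LegitModel n S3) (L : List (Fin n)) (f g : BF n) : Mdl.M :=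
  mux Mdl (F Mdl L g) (notA Mdl (F Mdl L (xr f g))) (notA Mdl (F Mdl L g)) (F Mdl L (xr f g))

def V' (Mdl : LegitModel n S3) (L : List (Fin n)) (f : BF n) :
    ℕ → BF n → List (Set (Fin n → Bool))
  | 0, g => muxErrs Mdl (F Mdl L g) (notA Mdl (F Mdl L (xr f g))) (notA Mdl (F Mdl L g))
      (F Mdl L (xr f g))
  | k + 1, g => V Mdl L k g

theorem xr_card (f : BF n) (Q : BF n → Prop) :
    #{h : BF n | Q (xr f h)} = #{h : BF n | Q h} := by
  refine Finset.card_nbij' (xr f) (xr f) ?_ ?_ ?_ ?_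
  · intro h hh
    simpa using hh
  · intro h hh
    simp only [Finset.coe_filter, Finset.mem_univ, true_and, Set.mem_setOf_eq] at hh ⊢
    rwa [xr_xr]
  · intro h _; exact xr_xr f h
  · intro h _; exact xr_xr f h

theorem P_G (Mdl : LegitModel n S3) (J : Set (Fin n)) (L : List (Fin n)) (hL : ∀ i ∈ L, i ∈ J)
    (f g : BF n) : P Mdl J (G Mdl L f g) :=
  P_mux _ _ _ _ _ _ (P_F _ _ _ hL _) (P_not _ _ _ (P_F _ _ _ hL _))
    (P_not _ _ _ (P_F _ _ _ hL _)) (P_F _ _ _ hL _)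

theorem V'_mem (Mdl : LegitModel n S3) (hz : Mdl.ZeroProjective) (J : Set (Fin n))
    (L : List (Fin n)) (hL : ∀ i ∈ L, i ∈ J) (f : BF n) (k : ℕ)
    (h : BF n) : (V' Mdl L f k h).length ≤ 3 ∧ ∀ δ ∈ V' Mdl L f k h, δ ∈ ErrJ Mdl J := by
  cases k with
  | zero =>
    exact ⟨le_rfl, muxErrs_mem _ hz _ _ _ _ _ (P_F _ _ _ hL _) (P_not _ _ _ (P_F _ _ _ hL _))
      (P_not _ _ _ (P_F _ _ _ hL _)) (P_F _ _ _ hL _)⟩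
  | succ k => exact V_mem Mdl hz J L hL k h

theorem G_count (Mdl : LegitModel n S3) (hn : Mdl.NegExact) (x : Fin n → Bool)
    (L : List (Fin n)) (f : BF n) (hf : f (pt L x) = f x) :
    #{g : BF n | (G Mdl L f g).1 x ≠ f x} ≤
      2 * ∑ k ∈ range (L.length + 1), #{h : BF n | ∃ δ ∈ V' Mdl L f k h, x ∈ δ} := by
  rw [Finset.sum_range_succ']
  change _ ≤ 2 * ((∑ k ∈ range L.length, #{h : BF n | ∃ δ ∈ V Mdl L k h, x ∈ δ}) + _)
  have h1 := F_count Mdl hn x L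
  have h2 : #{h : BF n | (F Mdl L (xr f h)).1 x ≠ (xr f h) (pt L x)} =
      #{h : BF n | (F Mdl L h).1 x ≠ h (pt L x)} := by
    convert xr_card f (fun h => (F Mdl L h).1 x ≠ h (pt L x))
  set A : Finset (BF n) := {h : BF n | (F Mdl L h).1 x ≠ h (pt L x)} with hA
  set B : Finset (BF n) := {h : BF n | (F Mdl L (xr f h)).1 x ≠ (xr f h) (pt L x)} with hB
  set D : Finset (BF n) := {h : BF n | ∃ δ ∈ V' Mdl L f 0 h, x ∈ δ} with hD
  have h3 : ({g : BF n | (G Mdl L f g).1 x ≠ f x} : Finset (BF n)) ⊆ (A ∪ B) ∪ D := by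
    intro g hg
    by_contra hcon
    simp only [hA, hB, hD, Finset.mem_union, Finset.mem_filter, Finset.mem_univ, true_and,
      not_or] at hcon hg
    obtain ⟨⟨c1, c2⟩, c3⟩ := hcon
    rw [not_not] at c1 c2
    have h4 := mux_val _ _ _ _ _ _ c3
    change (G Mdl L f g).1 x = _ at h4
    rw [notA_val Mdl hn, notA_val Mdl hn, c1, c2] at h4
    apply hg
    rw [h4]
    simp only [xr, hf]
    cases f x <;> cases g (pt L x) <;> rfl
  have h5 := Finset.card_le_card h3
  have h6 := Finset.card_union_le (A ∪ B) D
  have h7 := Finset.card_union_le A B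
  omega

def T (Mdl : LegitModel n S3) : List Mdl.M → ℕ → Mdl.M
  | _, 0 => cs Mdl true
  | [], _ + 1 => cs Mdl false
  | a :: l, j + 1 => orA Mdl (T Mdl l (j + 1)) (andA Mdl a (T Mdl l j))

theorem P_T (Mdl : LegitModel n S3) (J : Set (Fin n)) (l : List Mdl.M) (hl : ∀ a ∈ l, P Mdl J a)
    (j : ℕ) : P Mdl J (T Mdl l j) := by
  induction l generalizing j with
  | nil => cases j <;> exact P_const _ _ _
  | cons a l ih =>
    have ih := ih (fun j hj => hl j (List.mem_cons_of_mem _ hj))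
    cases j with
    | zero => exact P_const _ _ _
    | succ j => exact P_or _ _ _ _ (ih _) (P_and _ _ _ _ (hl a List.mem_cons_self) (ih _))

theorem T_spec (Mdl : LegitModel n S3) (hz : Mdl.ZeroProjective) (J : Set (Fin n))
    (k : ℕ) (l : List Mdl.M) (hl : ∀ a ∈ l, P Mdl J a) :
    ∃ E : List (Set (Fin n → Bool)), E.length ≤ 2 * k * l.length ∧ (∀ δ ∈ E, δ ∈ ErrJ Mdl J) ∧
      ∀ x, (∀ δ ∈ E, x ∉ δ) → ∀ j ≤ k, (T Mdl l j).1 x = decide (j ≤ l.countP (fun a => a.1 x)) := by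
  induction l with
  | nil =>
    refine ⟨[], by simp, by simp, fun x _ j _ => ?_⟩
    cases j <;> simp [T, cs]
  | cons a l ih =>
    have hl' := (fun j hj => hl j (List.mem_cons_of_mem _ hj))
    have ha := hl a List.mem_cons_self
    obtain ⟨E, h1, h2, h3⟩ := ih hl'
    refine ⟨E ++ (List.range k).flatMap (fun j => [dAnd Mdl a (T Mdl l j),
      dOr Mdl (T Mdl l (j + 1)) (andA Mdl a (T Mdl l j))]), ?_, ?_, ?_⟩
    · simp
      nlinarith
    · intro δ hδ
      rw [List.mem_append] at hδ
      rcases hδ with hδ | hδ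
      · exact h2 δ hδ
      · simp only [List.mem_flatMap, List.mem_cons, List.not_mem_nil, or_false] at hδ
        obtain ⟨j, -, rfl | rfl⟩ := hδ
        · exact dAnd_mem _ hz _ _ _ ha (P_T _ _ _ hl' _)
        · exact dOr_mem _ hz _ _ _ (P_T _ _ _ hl' _) (P_and _ _ _ _ ha (P_T _ _ _ hl' _))
    · intro x hx j hj
      have h3 := h3 x (fun δ hδ => hx δ (List.mem_append_left _ hδ))
      cases j with
      | zero => simp [T, cs]
      | succ j =>
        have e1 := hx (dAnd Mdl a (T Mdl l j)) (List.mem_append_right _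
          (List.mem_flatMap.2 ⟨j, List.mem_range.2 (by omega), by simp⟩))
        have e2 := hx (dOr Mdl (T Mdl l (j + 1)) (andA Mdl a (T Mdl l j))) (List.mem_append_right _
          (List.mem_flatMap.2 ⟨j, List.mem_range.2 (by omega), by simp⟩))
        rw [mem_dAnd, not_not] at e1
        rw [mem_dOr, not_not] at e2
        rw [T, ← e2, ← e1, h3 _ hj, h3 j (by omega), List.countP_cons]
        cases hax : a.1 x
        · simp
        · simp
          omega

theorem ess_inv (f : BF n) (z y : Fin n → Bool) (h : ∀ j, Essential f j → z j = y j) :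
    f z = f y := by
  have upd : ∀ (i : Fin n), ¬ Essential f i → ∀ x b, f (Function.update x i b) = f x := by
    intro i hi x b
    by_cases hb : b = x i
    · subst hb; simp
    · have : b = !(x i) := by
        cases b <;> cases hx : x i <;> simp_all
      subst this
      by_contra hc
      exact hi ⟨x, hc⟩
  have key : ∀ s : Finset (Fin n), f (s.piecewise z y) = f y := by
    intro s
    induction s using Finset.induction_on with
    | empty => simp
    | insert i s his ih =>
      rw [Finset.piecewise_insert]
      by_cases hi : Essential f i
      · have : Function.update (s.piecewise z y) i (z i) = s.piecewise z y := by
          rw [h i hi]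
          funext j
          by_cases hj : j = i
          · subst hj; simp [his]
          · simp [hj]
        rw [this, ih]
      · rw [upd i hi, ih]
  have := key univ
  simpa using this

theorem final (Mdl : LegitModel n S3) (hn : Mdl.NegExact) (hz : Mdl.ZeroProjective)
    (f : BF n) (J : Set (Fin n)) (hJ : J = {i | Essential f i}) (L : List (Fin n))
    (hL : ∀ i, i ∈ L ↔ i ∈ J) (hnd : L.Nodup) (m : ℕ) (hm : L.length = m) :
    ∃ g ∈ Mdl.M, ∃ E : List (Set (Fin n → Bool)),
      E.length ≤ 3 * (30 * (m + 1) * (m + 1)) + 2 * (m + 1) * (2 * m + 1) ∧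
      (∀ δ ∈ E, δ ∈ Mdl.Delta) ∧ ∀ x, f x ≠ g x → ∃ δ ∈ E, x ∈ δ := by
  have hLJ : ∀ i ∈ L, i ∈ J := fun i hi => (hL i).1 hi
  have agree : ∀ x, ∀ j ∈ J, x j = pt L x j := by
    intro x j hj
    rw [pt_val L hnd, if_pos ((hL j).2 hj)]
  have finv : ∀ x, f x = f (pt L x) := fun x =>
    ess_inv f _ _ (fun j hj => agree x j (by rw [hJ]; exact hj))
  let X : Finset (Fin n → Bool) := univ.image (pt L)
  have hX : #X ≤ 2 ^ m := hm ▸ pt_card L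
  let A : Fin (m + 1) × BF n → Set (Fin n → Bool) :=
    fun p => {x | ∃ δ ∈ V' Mdl L f p.1.val p.2, x ∈ δ}
  let q := 30 * (m + 1)
  let Bd : Finset (Fin n → Bool) :=
    {x ∈ X | Fintype.card (Fin (m + 1) × BF n) ≤ q * #{i | x ∈ A i}}
  let Gd : Finset (Fin n → Bool) :=
    {x ∈ X | ¬ Fintype.card (Fin (m + 1) × BF n) ≤ q * #{i | x ∈ A i}}
  obtain ⟨l1, hl1, hc1⟩ := greedy_cover' Bd A q m (by simp only [q]; omega)
    ((Finset.card_le_card (Finset.filter_subset _ _)).trans hX)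
    (fun x hx => by convert (Finset.mem_filter.1 hx).2)
  obtain ⟨l2, hl2, hc2⟩ := greedy_maj' Gd (fun g x => (G Mdl L f g).1 x ≠ f x) m
    ((Finset.card_le_card (Finset.filter_subset _ _)).trans hX) (by
      intro x hx
      have h1 := (Finset.mem_filter.1 hx).2
      have h2 := G_count Mdl hn x L f (finv x).symm
      have h3 : #{i | x ∈ A i} =
          ∑ k ∈ range (L.length + 1), #{h : BF n | ∃ δ ∈ V' Mdl L f k h, x ∈ δ} := by
        rw [hm, Finset.sum_range]
        simp only [Finset.card_filter]
        rw [Fintype.sum_prod_type]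
        rfl
      rw [← h3] at h2
      rw [Fintype.card_prod, Fintype.card_fin] at h1
      simp only [q] at h1
      set N := #{i | x ∈ A i}
      have h4 : 30 * N ≤ Fintype.card (BF n) := by
        by_contra hcon
        apply h1
        calc (m + 1) * Fintype.card (BF n) ≤ (m + 1) * (30 * N) :=
              Nat.mul_le_mul_left _ (by omega)
          _ = 30 * (m + 1) * N := by ring
      refine le_trans (Nat.mul_le_mul_left 15 (le_trans (le_of_eq ?_) h2)) (by omega)
      congr)
  have hP : ∀ a ∈ l2.map (G Mdl L f), P Mdl J a := by
    intro a ha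
    obtain ⟨g, -, rfl⟩ := List.mem_map.1 ha
    exact P_G Mdl J L hLJ f g
  obtain ⟨E, hE1, hE2, hE3⟩ := T_spec Mdl hz J (m + 1) (l2.map (G Mdl L f)) hP
  let R := T Mdl (l2.map (G Mdl L f)) (m + 1)
  have hR : P Mdl J R := P_T Mdl J _ hP _
  let E1 := l1.flatMap (fun p => V' Mdl L f p.1.val p.2)
  have hE1J : ∀ δ ∈ E1 ++ E, δ ∈ ErrJ Mdl J := by
    intro δ hδ
    rcases List.mem_append.1 hδ with h | h
    · obtain ⟨p, -, hp⟩ := List.mem_flatMap.1 h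
      exact (V'_mem Mdl hz J L hLJ f _ _).2 δ hp
    · exact hE2 δ h
  refine ⟨R.1, R.2, E1 ++ E, ?_, fun δ hδ => (hE1J δ hδ).1, ?_⟩
  · rw [List.length_append]
    have h1 : E1.length ≤ 3 * l1.length := by
      simp only [E1]
      clear hc1 hl1
      induction l1 with
      | nil => simp
      | cons p l ih =>
        rw [List.flatMap_cons, List.length_append, List.length_cons]
        have := (V'_mem Mdl hz J L hLJ f p.1.val p.2).1
        specialize ih (by
          intro δ hδ
          rcases List.mem_append.1 hδ with h | h
          · obtain ⟨p, -, hp⟩ := List.mem_flatMap.1 h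
            exact (V'_mem Mdl hz J L hLJ f _ _).2 δ hp
          · exact hE2 δ h)
        omega
    rw [List.length_map, hl2] at hE1
    rw [hl1] at h1
    exact Nat.add_le_add h1 hE1
  · intro x hx
    by_contra hcon
    push Not at hcon
    apply hx
    rw [finv x, P_inv Mdl hz J R hR x _ (agree x)]
    have hcon' : ∀ δ ∈ E1 ++ E, pt L x ∉ δ := fun δ hδ =>
      fun h => hcon δ hδ (((hE1J δ hδ).2 x _ (agree x)).2 h)
    have hyX : pt L x ∈ X := Finset.mem_image_of_mem _ (Finset.mem_univ _)
    generalize pt L x = y at *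
    have hyG : y ∈ Gd := by
      refine Finset.mem_filter.2 ⟨hyX, fun h => ?_⟩
      obtain ⟨p, hp, δ, hδ, hyδ⟩ := hc1 y (Finset.mem_filter.2 ⟨hyX, h⟩)
      exact hcon' δ (List.mem_append_left _ (List.mem_flatMap.2 ⟨p, hp, hδ⟩)) hyδ
    have h1 := hc2 y hyG
    have h2 := hE3 y (fun δ hδ => hcon' δ (List.mem_append_right _ hδ)) (m + 1) le_rfl
    change f y = (T Mdl (l2.map (G Mdl L f)) (m + 1)).1 y
    rw [h2, List.countP_map]
    have h3 := List.length_eq_countP_add_countP (fun g => (G Mdl L f g).1 y) (l := l2)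
    have e0 : ((fun a : Mdl.M => a.1 y) ∘ G Mdl L f) = fun g => (G Mdl L f g).1 y := rfl
    rw [e0]
    cases hfy : f y
    · have h1' : l2.countP (fun g => (G Mdl L f g).1 y) ≤ m := by
        refine le_trans (le_of_eq ?_) h1
        apply List.countP_congr
        intro g _
        simp [hfy]
      symm
      simp only [decide_eq_false_iff_not]
      omega
    · have h1' : l2.countP (fun g => decide (¬ (G Mdl L f g).1 y = true)) ≤ m := by
        refine le_trans (le_of_eq ?_) h1
        apply List.countP_congr
        intro g _
        simp [hfy]
      symm
      simp only [decide_eq_true_eq]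
      omega

end Aux

end
noncomputable section

theorem stmt5 :
    ∃ K : ℕ, ∀ (n : ℕ) (Mdl : LegitModel n S3), Mdl.NegExact → Mdl.ZeroProjective →
      ∀ f : BF n, Mdl.rho f ≤ ((K * essCount f ^ 2 : ℕ) : ℕ∞) := by
  refine ⟨400, fun n Mdl hn hz f => ?_⟩
  have red : ∀ k, k ≤ 400 * essCount f ^ 2 → Mdl.CoversWith f k →
      Mdl.rho f ≤ ((400 * essCount f ^ 2 : ℕ) : ℕ∞) := by
    intro k hk hc
    refine le_trans (sInf_le ⟨k, rfl, hc⟩) ?_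
    exact_mod_cast hk
  let s : Finset (Fin n) := Finset.univ.filter (fun i => Essential f i)
  have hs : essCount f = s.card := by
    unfold essCount
    rw [← Set.ncard_coe_finset]
    congr 1
    ext i
    simp [s]
  by_cases h0 : s.card = 0
  · refine red 0 (Nat.zero_le _) ⟨fun _ => f (fun _ => false), Mdl.const_mem _,
      fun i => i.elim0, fun i => i.elim0, fun x hx => ?_⟩
    exfalso
    apply hx
    apply Aux.ess_inv
    intro j hj
    rw [Finset.card_eq_zero] at h0
    have : j ∈ s := by simp [s, hj]
    rw [h0] at this
    simp at this
  · obtain ⟨g, hg, E, hE, hD, hcov⟩ := Aux.final Mdl hn hz f _ rfl s.toList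
      (by intro i; simp [s]) (Finset.nodup_toList s) s.card (by simp)
    refine red E.length ?_ ⟨g, hg, E.get, fun i => hD _ (List.get_mem _ _), fun x hx => ?_⟩
    · refine hE.trans ?_
      rw [hs]
      generalize s.card = m at *
      obtain ⟨p, rfl⟩ : ∃ p, m = p + 1 := ⟨m - 1, by omega⟩
      nlinarith
    · obtain ⟨δ, hδ, hx⟩ := hcov x hx
      obtain ⟨i, rfl⟩ := List.get_of_mem hδ
      exact ⟨i, hx⟩

end
end
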